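/- arXiv:1807.10905 — 2 statements merged into one kernel-verified Lean document; each statement's English description precedes it below -/
import Mathlib

section
/- Let n ≥ 4 and set A = 𝒯 if n ≥ 5 and A = 𝒯̃ if n = 4. Let R ≥ 1, N ≥ 1 an integer, and q_N = N(n−1). Let g be a smooth map from {x ∈ ℝⁿ : |x| ≥ R} to the n×n real matrices such that g(x) is invertible for every x, each entry satisfies g_{ij} − δ_{ij} = O(−(n−1)), and each g_{ij} − δ_{ij} has an expansion with terms in A up to order −q_N. Write g^{ij} for the entries of the pointwise inverse matrix, and define Γ^k_{pr} := (1/2) Σ_m g^{km}(∂_r g_{pm} + ∂_p g_{mr} − ∂_m g_{pr}), Q_{ij} := −Σ_{k,l,p,q} g^{pq} g_{lj} (∂_p g_{ik})(∂_q g^{kl}) − 2 Σ_{k,l,p,q,r,s} g_{ik} g_{lj} g^{pq} g^{rs} Γ^k_{pr} Γ^l_{qs}, and RHS_{ij} := −Σ_{k,l} (g^{kl} − δ^{kl}) ∂_k ∂_l g_{ij} + Q_{ij}. Then each RHS_{ij} has an expansion with terms in 𝓛_{A×A} up to order −(q_N + n + 1); that is, RHS_{ij} = RHS_{q_N,ij}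 + O(−(q_N+n+1)−ε) for some ε ∈ (0,1), where RHS_{q_N,ij} is a finite real linear combination of products T₁·T₂ with T₁, T₂ ∈ A. -/
open Real
open scoped BigOperators

noncomputable section

abbrev E (n : ℕ) := EuclideanSpace ℝ (Fin n)

/-- The Euclidean Laplacian of `f` at `x` (sum of second partial derivatives). -/
def lap (n : ℕ) (f : E n → ℝ) (x : E n) : ℝ :=
  ∑ i : Fin n, fderiv ℝ (fun y => fderiv ℝ f y (EuclideanSpace.single i 1)) x
    (EuclideanSpace.single i 1)

/-- `f` is a (real) polynomial function on `ℝⁿ`. -/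
def IsPolyFun (n : ℕ) (f : E n → ℝ) : Prop :=
  ∃ P : MvPolynomial (Fin n) ℝ, ∀ x : E n, f x = MvPolynomial.eval (fun i => x i) P

/-- `p` is a harmonic homogeneous polynomial of degree `m` on `ℝⁿ`. -/
def IsHHP (n m : ℕ) (p : E n → ℝ) : Prop :=
  IsPolyFun n p ∧ (∀ (c : ℝ) (x : E n), p (c • x) = c ^ m * p x) ∧ ∀ x : E n, lap n p x = 0

/-- The exterior region `{x : ℝⁿ | R ≤ |x|}`. -/
def Sset (n : ℕ) (R : ℝ) : Set (E n) := {x : E n | R ≤ ‖x‖}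

/-- `u = O(-q)` on `{|x| ≥ R}`: all rescaled iterated derivatives decay like `|x|^{-q}`. -/
def BigOh (n : ℕ) (R q : ℝ) (u : E n → ℝ) : Prop :=
  ∀ j : ℕ, ∃ C : ℝ, ∀ x ∈ Sset n R,
    ‖x‖ ^ j * ‖iteratedFDerivWithin ℝ j u (Sset n R) x‖ ≤ C * ‖x‖ ^ (-q)

/-- `u` has an expansion with terms in `A` up to order `-q` on `{|x| ≥ R}`. -/
def HasExpansion (n : ℕ) (R : ℝ) (A : Set (E n → ℝ)) (q : ℝ) (u : E n → ℝ) : Prop :=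
  ∃ ε : ℝ, ε ∈ Set.Ioo (0:ℝ) 1 ∧ ∃ v ∈ Submodule.span ℝ A,
    BigOh n R (q + ε) (fun x => u x - v x)

/-- The set `𝒯`: functions `|x|^{σ-m} p(x)`, `σ = 2j - (n-2)l - k`,
`k ≥ l ≥ j+1`, `k ≥ m`, `k - m` even. -/
def Tset (n : ℕ) : Set (E n → ℝ) :=
  {f | ∃ (j l k m : ℕ) (p : E n → ℝ), IsHHP n m p ∧ j + 1 ≤ l ∧ l ≤ k ∧ m ≤ k ∧
    Even (k - m) ∧
    f = fun x => ‖x‖ ^ ((2 * (j:ℝ) - ((n:ℝ) - 2) * l - k) - m) * p x}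

/-- The set `𝒯̃` (its `n`-parametrized form; at `n = 4` the exponent
`(2-n)l - k - m` is `-2l - k - m`): functions `|x|^{(2-n)l-k-m} (log|x|)^i p(x)`,
`l ≥ 1`, `k ≥ l + i`, `k ≥ m`, `k - m` even. -/
def TtildeG (n : ℕ) : Set (E n → ℝ) :=
  {f | ∃ (l k i m : ℕ) (p : E n → ℝ), IsHHP n m p ∧ 1 ≤ l ∧ l + i ≤ k ∧ m ≤ k ∧
    Even (k - m) ∧
    f = fun x => ‖x‖ ^ (((2:ℝ) - n) * l - k - m) * (Real.log ‖x‖) ^ i * p x}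

/-- Partial derivative (within `{|x| ≥ R}`) in the `i`-th coordinate direction. -/
def pd (n : ℕ) (R : ℝ) (f : E n → ℝ) (i : Fin n) (x : E n) : ℝ :=
  fderivWithin ℝ f (Sset n R) x (EuclideanSpace.single i 1)

theorem uniqueDiffOn_Sset (n : ℕ) {R : ℝ} (hR : 1 ≤ R) : UniqueDiffOn ℝ (Sset n R) := by
  intro x hx
  have hx' : R ≤ ‖x‖ := hx
  have hx0 : 0 < ‖x‖ := by linarith
  set H : Set (E n) := {y | ‖x‖ ^ 2 ≤ inner ℝ x y} with hH
  have hconv : Convex ℝ H := by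
    have : H = (innerSL ℝ x) ⁻¹' Set.Ici (‖x‖ ^ 2) := by
      ext y; simp [hH]
    rw [this]
    exact (convex_Ici _).linear_preimage (innerSL ℝ x).toLinearMap
  have hHint : (interior H).Nonempty := by
    have hopen : IsOpen {y : E n | ‖x‖ ^ 2 < inner ℝ x y} :=
      isOpen_lt continuous_const (by fun_prop)
    have hsub : {y : E n | ‖x‖ ^ 2 < inner ℝ x y} ⊆ H := by
      intro y hy
      have hy' : ‖x‖ ^ 2 < inner ℝ x y := hy
      exact hy'.le
    refine ⟨(2 : ℝ) • x, interior_maximal hsub hopen ?_⟩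
    simp only [Set.mem_ofPred_eq, inner_smul_right, real_inner_self_eq_norm_sq]
    nlinarith
  have hsub : H ⊆ Sset n R := by
    intro y hy
    have h1 : ‖x‖ ^ 2 ≤ ‖x‖ * ‖y‖ := le_trans hy (real_inner_le_norm x y)
    have h2 : ‖x‖ ≤ ‖y‖ := by nlinarith
    exact le_trans hx' h2
  refine (uniqueDiffWithinAt_convex hconv hHint (subset_closure ?_)).mono hsub
  simp [hH]

/-- Smooth functions on `{|x| ≥ R}` which are `O(-q)`. -/
structure SmoothBigOh (n : ℕ) (R q : ℝ) (u : E n → ℝ) : Prop where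
  smooth : ContDiffOn ℝ (⊤ : ℕ∞) u (Sset n R)
  bigOh : BigOh n R q u

theorem norm_pos_of_mem_Sset {n : ℕ} {R : ℝ} (hR : 1 ≤ R) {x : E n} (hx : x ∈ Sset n R) :
    1 ≤ ‖x‖ := le_trans hR hx

theorem BigOh.exists_nonneg {n : ℕ} {R q : ℝ} {u : E n → ℝ} (h : BigOh n R q u) (j : ℕ) :
    ∃ C : ℝ, 0 ≤ C ∧ ∀ x ∈ Sset n R,
      ‖x‖ ^ j * ‖iteratedFDerivWithin ℝ j u (Sset n R) x‖ ≤ C * ‖x‖ ^ (-q) := by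
  obtain ⟨C, hC⟩ := h j
  refine ⟨max C 0, le_max_right _ _, fun x hx => (hC x hx).trans ?_⟩
  gcongr
  exact le_max_left _ _

theorem ContDiffOn.at_nat {n : ℕ} {S : Set (E n)} {u : E n → ℝ}
    (h : ContDiffOn ℝ (⊤ : ℕ∞) u S) (j : ℕ) : ContDiffOn ℝ j u S :=
  h.of_le (by exact_mod_cast le_top)

namespace SmoothBigOh

variable {n : ℕ} {R q q' : ℝ} {u v : E n → ℝ}

theorem mono (hR : 1 ≤ R) (h : SmoothBigOh n R q u) (hq : q' ≤ q) : SmoothBigOh n R q' u := by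
  refine ⟨h.smooth, fun j => ?_⟩
  obtain ⟨C, hC0, hC⟩ := h.bigOh.exists_nonneg j
  refine ⟨C, fun x hx => (hC x hx).trans ?_⟩
  have := norm_pos_of_mem_Sset hR hx
  gcongr

theorem congr (h : SmoothBigOh n R q u) (huv : Set.EqOn v u (Sset n R)) :
    SmoothBigOh n R q v := by
  refine ⟨h.smooth.congr huv, fun j => ?_⟩
  obtain ⟨C, hC⟩ := h.bigOh j
  refine ⟨C, fun x hx => ?_⟩
  rw [iteratedFDerivWithin_congr huv hx]
  exact hC x hx

theorem add (hR : 1 ≤ R) (hu : SmoothBigOh n R q u) (hv : SmoothBigOh n R q v) :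
    SmoothBigOh n R q (fun x => u x + v x) := by
  refine ⟨hu.smooth.add hv.smooth, fun j => ?_⟩
  obtain ⟨C, hC⟩ := hu.bigOh j
  obtain ⟨D, hD⟩ := hv.bigOh j
  refine ⟨C + D, fun x hx => ?_⟩
  have h1 := iteratedFDerivWithin_add_apply (hu.smooth.at_nat j x hx) (hv.smooth.at_nat j x hx)
    (uniqueDiffOn_Sset n hR) hx
  have h2 : (fun x => u x + v x) = u + v := rfl
  rw [h2, h1]
  calc _ ≤ ‖x‖ ^ j * (‖iteratedFDerivWithin ℝ j u (Sset n R) x‖ +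
        ‖iteratedFDerivWithin ℝ j v (Sset n R) x‖) := by
        gcongr; exact norm_add_le _ _
    _ ≤ _ := by rw [mul_add, add_mul]; exact add_le_add (hC x hx) (hD x hx)

theorem const (c : ℝ) : SmoothBigOh n R 0 (fun _ => c) := by
  refine ⟨contDiffOn_const, fun j => ?_⟩
  rcases Nat.eq_zero_or_pos j with rfl | hj
  · exact ⟨|c|, fun _ _ => by simp⟩
  · refine ⟨0, fun _ _ => ?_⟩
    rw [iteratedFDerivWithin_const_of_ne hj.ne']
    simp

theorem mul (hR : 1 ≤ R) (hu : SmoothBigOh n R q u) (hv : SmoothBigOh n R q' v) :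
    SmoothBigOh n R (q + q') (fun x => u x * v x) := by
  refine ⟨hu.smooth.mul hv.smooth, fun j => ?_⟩
  choose C hC0 hC using hu.bigOh.exists_nonneg
  choose D hD0 hD using hv.bigOh.exists_nonneg
  refine ⟨∑ i ∈ Finset.range (j + 1), (j.choose i : ℝ) * (C i * D (j - i)), fun x hx => ?_⟩
  have hx0 : 0 < ‖x‖ := by linarith [norm_pos_of_mem_Sset hR hx]
  have h1 := norm_iteratedFDerivWithin_mul_le (hu.smooth.at_nat j) (hv.smooth.at_nat j)
    (uniqueDiffOn_Sset n hR) hx (n := j) le_rfl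
  refine (mul_le_mul_of_nonneg_left h1 (by positivity)).trans ?_
  rw [Finset.mul_sum, Finset.sum_mul]
  refine Finset.sum_le_sum fun i hi => ?_
  have hij : i ≤ j := Nat.lt_succ_iff.mp (Finset.mem_range.mp hi)
  have h2 : ‖x‖ ^ j = ‖x‖ ^ i * ‖x‖ ^ (j - i) := by rw [← pow_add, Nat.add_sub_cancel' hij]
  have h3 : ‖x‖ ^ (-(q + q')) = ‖x‖ ^ (-q) * ‖x‖ ^ (-q') := by
    rw [← Real.rpow_add hx0]; congr 1; ring
  rw [h2, h3]
  have h4 := mul_le_mul (hC i x hx) (hD (j - i) x hx) (by positivity)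
    (mul_nonneg (hC0 i) (by positivity))
  have h5 := mul_le_mul_of_nonneg_left h4 (Nat.cast_nonneg (α := ℝ) (j.choose i))
  refine le_of_eq_of_le ?_ (h5.trans_eq ?_) <;> ring

theorem neg (hR : 1 ≤ R) (hu : SmoothBigOh n R q u) : SmoothBigOh n R q (fun x => -u x) := by
  have := (const (n := n) (R := R) (-1)).mul hR hu
  rw [zero_add] at this
  exact this.congr fun _ _ => by simp

theorem sub (hR : 1 ≤ R) (hu : SmoothBigOh n R q u) (hv : SmoothBigOh n R q v) :
    SmoothBigOh n R q (fun x => u x - v x) :=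
  (hu.add hR (hv.neg hR)).congr fun _ _ => sub_eq_add_neg _ _

theorem sum (hR : 1 ≤ R) {ι : Type*} (s : Finset ι) {u : ι → E n → ℝ}
    (hu : ∀ i ∈ s, SmoothBigOh n R 0 (u i)) : SmoothBigOh n R 0 (fun x => ∑ i ∈ s, u i x) := by
  classical
  induction s using Finset.induction_on with
  | empty => exact (const 0).congr fun x _ => by simp
  | insert a s ha ih =>
    refine ((hu a (by simp)).add hR (ih fun i hi => hu i (by simp [hi]))).congr fun _ _ => ?_
    simp [Finset.sum_insert ha]

theorem prod (hR : 1 ≤ R) {ι : Type*} (s : Finset ι) {u : ι → E n → ℝ}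
    (hu : ∀ i ∈ s, SmoothBigOh n R 0 (u i)) : SmoothBigOh n R 0 (fun x => ∏ i ∈ s, u i x) := by
  classical
  induction s using Finset.induction_on with
  | empty => exact (const 1).congr fun x _ => by simp
  | insert a s ha ih =>
    have := (hu a (by simp)).mul hR (ih fun i hi => hu i (by simp [hi]))
    rw [zero_add] at this
    refine this.congr fun _ _ => ?_
    simp [Finset.prod_insert ha]

theorem det (hR : 1 ≤ R) {M : E n → Matrix (Fin n) (Fin n) ℝ}
    (hM : ∀ i j, SmoothBigOh n R 0 (fun x => M x i j)) :
    SmoothBigOh n R 0 (fun x => (M x).det) := by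
  simp only [Matrix.det_apply']
  refine sum hR _ fun σ _ => ?_
  have := (const (n := n) (R := R) ((Equiv.Perm.sign σ : ℤ) : ℝ)).mul hR
    (prod hR Finset.univ fun i _ => hM (σ i) i)
  rwa [zero_add] at this

theorem pd (hR : 1 ≤ R) (hu : SmoothBigOh n R q u) (i : Fin n) :
    SmoothBigOh n R (q + 1) (pd n R u i) := by
  have hS := uniqueDiffOn_Sset n hR
  have hsm : ContDiffOn ℝ (⊤ : ℕ∞) (fderivWithin ℝ u (Sset n R)) (Sset n R) :=
    hu.smooth.fderivWithin hS (by simp)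
  refine ⟨hsm.clm_apply contDiffOn_const, fun j => ?_⟩
  obtain ⟨C, hC0, hC⟩ := hu.bigOh.exists_nonneg (j + 1)
  refine ⟨C, fun x hx => ?_⟩
  have hx0 : 0 < ‖x‖ := by linarith [norm_pos_of_mem_Sset hR hx]
  have h1 := norm_iteratedFDerivWithin_clm_apply_const (c := EuclideanSpace.single i (1 : ℝ))
    (hsm x hx) hS hx (n := j) (by exact_mod_cast le_top)
  rw [norm_iteratedFDerivWithin_fderivWithin hS hx] at h1
  have h0 : ‖EuclideanSpace.single i (1 : ℝ)‖ = 1 := by simp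
  rw [h0, one_mul] at h1
  have h2 := hC x hx
  have h3 : ‖x‖ ^ (-q) = ‖x‖ ^ (-(q + 1)) * ‖x‖ := by
    rw [← Real.rpow_add_one hx0.ne']; congr 1; ring
  rw [h3, pow_succ] at h2
  refine (mul_le_mul_of_nonneg_left h1 (by positivity)).trans ?_
  refine le_of_mul_le_mul_right ?_ hx0
  linarith

theorem inv (hR : 1 ≤ R) (hu : SmoothBigOh n R 0 u) {c : ℝ} (hc : 0 < c)
    (huc : ∀ x ∈ Sset n R, c ≤ |u x|) : SmoothBigOh n R 0 (fun x => (u x)⁻¹) := by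
  have hS := uniqueDiffOn_Sset n hR
  have hne : ∀ x ∈ Sset n R, u x ≠ 0 := fun x hx => abs_pos.mp (hc.trans_le (huc x hx))
  refine ⟨hu.smooth.inv hne, fun j => ?_⟩
  choose C hC0 hC using hu.bigOh.exists_nonneg
  set K : ℝ := 1 + ∑ i ∈ Finset.range (j + 1), C i with hK
  set M : ℝ := ∑ i ∈ Finset.range (j + 1), (i.factorial : ℝ) * c⁻¹ ^ (i + 1) with hM
  have hK1 : 1 ≤ K := by
    have : 0 ≤ ∑ i ∈ Finset.range (j + 1), C i := Finset.sum_nonneg fun i _ => hC0 i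
    linarith
  refine ⟨j.factorial * M * K ^ j, fun x hx => ?_⟩
  have hx0 : 0 < ‖x‖ := by linarith [norm_pos_of_mem_Sset hR hx]
  have hopen : IsOpen ({0}ᶜ : Set ℝ) := isOpen_compl_singleton
  have hinv : ContDiffOn ℝ (⊤ : ℕ∞) (Inv.inv : ℝ → ℝ) ({0}ᶜ) := fun t ht =>
    (contDiffAt_inv ℝ ht).contDiffWithinAt
  have key := norm_iteratedFDerivWithin_comp_le (n := j) (C := M) (D := K / ‖x‖) hinv hu.smooth
    (by exact_mod_cast le_top) hopen.uniqueDiffOn hS (fun y hy => hne y hy) hx ?_ ?_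
  · have h1 : (fun x => (u x)⁻¹) = Inv.inv ∘ u := rfl
    rw [h1]
    refine (mul_le_mul_of_nonneg_left key (by positivity)).trans_eq ?_
    rw [div_pow]
    field_simp
    simp
  · intro i hi
    rw [iteratedFDerivWithin_of_isOpen i hopen (hne x hx), norm_iteratedFDeriv_eq_norm_iteratedDeriv,
      iteratedDeriv_eq_iterate, iter_deriv_inv]
    have h1 : ‖(-1 : ℝ) ^ i * (i.factorial : ℝ) * u x ^ (-1 - (i : ℤ))‖
        = i.factorial * |u x|⁻¹ ^ (i + 1) := by
      have h0 : (-1 - (i : ℤ)) = -((i + 1 : ℕ) : ℤ) := by push_cast; ring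
      rw [h0, zpow_neg, zpow_natCast]
      simp
    rw [h1]
    have h2 : (i.factorial : ℝ) * |u x|⁻¹ ^ (i + 1) ≤ i.factorial * c⁻¹ ^ (i + 1) := by
      have := huc x hx
      gcongr
    refine h2.trans ?_
    exact Finset.single_le_sum (f := fun i : ℕ => (i.factorial : ℝ) * c⁻¹ ^ (i + 1))
      (fun k _ => by positivity) (Finset.mem_range.mpr (Nat.lt_succ_of_le hi))
  · intro i hi1 hij
    have h1 := hC i x hx
    simp only [neg_zero, Real.rpow_zero, mul_one] at h1
    have h2 : C i ≤ K := by
      have := Finset.single_le_sum (f := C) (fun k _ => hC0 k)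
        (Finset.mem_range.mpr (Nat.lt_succ_of_le hij))
      linarith
    have h3 : K ≤ K ^ i := le_self_pow₀ hK1 (by omega)
    rw [div_pow, le_div_iff₀ (by positivity), mul_comm]
    linarith

end SmoothBigOh

namespace MvPolynomial

variable {n : ℕ}

/-- The algebraic Laplacian. -/
def laplacian (n : ℕ) : MvPolynomial (Fin n) ℝ →ₗ[ℝ] MvPolynomial (Fin n) ℝ :=
  ∑ i, (pderiv i).toLinearMap ∘ₗ (pderiv i).toLinearMap

/-- The polynomial `|x|²`. -/
def normSq (n : ℕ) : MvPolynomial (Fin n) ℝ := ∑ i, X i ^ 2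

theorem laplacian_apply (P : MvPolynomial (Fin n) ℝ) :
    laplacian n P = ∑ i, pderiv i (pderiv i P) := by
  simp [laplacian]

theorem isHomogeneous_normSq (n : ℕ) : (normSq n).IsHomogeneous 2 :=
  IsHomogeneous.sum _ _ _ fun i _ => by simpa using (isHomogeneous_X ℝ i).pow 2

theorem pderiv_normSq (i : Fin n) : pderiv i (normSq n) = 2 * X i := by
  simp only [normSq, map_sum, Derivation.leibniz_pow, pderiv_X]
  rw [Finset.sum_eq_single i]
  · simp [nsmul_eq_mul]
  · intro j _ hj
    simp [hj]
  · simp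

theorem laplacian_normSq_mul {P : MvPolynomial (Fin n) ℝ} {e : ℕ} (hP : P.IsHomogeneous e) :
    laplacian n (normSq n * P) = (2 * n + 4 * e : ℝ) • P + normSq n * laplacian n P := by
  have h1 : ∀ i : Fin n, pderiv i (pderiv i (normSq n * P)) =
      2 * P + 4 * (X i * pderiv i P) + normSq n * pderiv i (pderiv i P) := by
    intro i
    have h2 : pderiv i (2 : MvPolynomial (Fin n) ℝ) = 0 := by
      simpa using (pderiv i).map_natCast (R := ℝ) 2
    simp only [Derivation.leibniz, map_add, pderiv_normSq, smul_eq_mul, pderiv_X_self, h2]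
    ring
  simp only [laplacian_apply, h1, Finset.sum_add_distrib, ← Finset.mul_sum,
    hP.sum_X_mul_pderiv]
  simp only [Finset.sum_const, Finset.card_univ, Fintype.card_fin, nsmul_eq_mul, smul_eq_C_mul,
    map_add, map_mul, map_natCast, map_ofNat]
  ring

theorem exists_laplacian_normSq_pow_mul (hn : 1 ≤ n) {H : MvPolynomial (Fin n) ℝ} {m : ℕ}
    (hH : H.IsHomogeneous m) (hharm : laplacian n H = 0) (s : ℕ) :
    ∃ c : ℝ, 0 < c ∧ laplacian n (normSq n ^ (s + 1) * H) = c • (normSq n ^ s * H) := by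
  have hn' : (1 : ℝ) ≤ n := by exact_mod_cast hn
  induction s with
  | zero =>
    refine ⟨2 * n + 4 * m, by positivity, ?_⟩
    simp [laplacian_normSq_mul hH, hharm]
  | succ s ih =>
    obtain ⟨c, hc, h⟩ := ih
    have hhom : (normSq n ^ (s + 1) * H).IsHomogeneous (2 * (s + 1) + m) :=
      ((isHomogeneous_normSq n).pow (s + 1)).mul hH
    refine ⟨2 * n + 4 * (2 * (s + 1) + m : ℕ) + c, by positivity, ?_⟩
    rw [pow_succ' _ (s + 1), mul_assoc, laplacian_normSq_mul hhom, h, mul_smul_comm, add_smul,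
      ← mul_assoc, ← pow_succ', add_smul, add_smul]

/-- Linear combinations of `|x|^{2s} H` with `H` harmonic, homogeneous of degree `d - 2s`. -/
def harmonicSpan (n d : ℕ) : Submodule ℝ (MvPolynomial (Fin n) ℝ) :=
  Submodule.span ℝ {W | ∃ (s m : ℕ) (H : MvPolynomial (Fin n) ℝ), 2 * s + m = d ∧
    H.IsHomogeneous m ∧ laplacian n H = 0 ∧ W = normSq n ^ s * H}

theorem isHomogeneous_of_mem_harmonicSpan {d : ℕ} {W : MvPolynomial (Fin n) ℝ}
    (hW : W ∈ harmonicSpan n d) : W.IsHomogeneous d := by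
  have : harmonicSpan n d ≤ homogeneousSubmodule (Fin n) ℝ d := by
    refine Submodule.span_le.mpr ?_
    rintro _ ⟨s, m, H, rfl, hH, -, rfl⟩
    exact ((isHomogeneous_normSq n).pow s).mul hH
  exact this hW

theorem exists_laplacian_eq_of_mem_harmonicSpan (hn : 1 ≤ n) {d : ℕ}
    {W : MvPolynomial (Fin n) ℝ} (hW : W ∈ harmonicSpan n d) :
    ∃ V ∈ harmonicSpan n (d + 2), laplacian n V = W := by
  induction hW using Submodule.span_induction with
  | mem W h =>
    obtain ⟨s, m, H, rfl, hH, hharm, rfl⟩ := h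
    obtain ⟨c, hc, h⟩ := exists_laplacian_normSq_pow_mul hn hH hharm s
    refine ⟨c⁻¹ • (normSq n ^ (s + 1) * H), Submodule.smul_mem _ _ (Submodule.subset_span
      ⟨s + 1, m, H, by ring, hH, hharm, rfl⟩), ?_⟩
    rw [map_smul, h, smul_smul, inv_mul_cancel₀ hc.ne', one_smul]
  | zero => exact ⟨0, Submodule.zero_mem _, map_zero _⟩
  | add a b _ _ ha hb =>
    obtain ⟨A, hA, rfl⟩ := ha
    obtain ⟨B, hB, rfl⟩ := hb
    exact ⟨A + B, Submodule.add_mem _ hA hB, map_add _ _ _⟩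
  | smul c a _ ha =>
    obtain ⟨A, hA, rfl⟩ := ha
    exact ⟨c • A, Submodule.smul_mem _ _ hA, map_smul _ _ _⟩

theorem IsHomogeneous.pderiv_eq_zero {P : MvPolynomial (Fin n) ℝ} (hP : P.IsHomogeneous 0)
    (i : Fin n) : pderiv i P = 0 := by
  rw [totalDegree_eq_zero_iff_eq_C.mp ((totalDegree_zero_iff_isHomogeneous (p := P)).mpr hP), pderiv_C]

theorem IsHomogeneous.laplacian {P : MvPolynomial (Fin n) ℝ} {d : ℕ} (hP : P.IsHomogeneous d) :
    (laplacian n P).IsHomogeneous (d - 2) := by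
  rw [laplacian_apply]
  exact IsHomogeneous.sum _ _ _ fun i _ => hP.pderiv.pderiv

/-- Every homogeneous polynomial is a combination of `|x|^{2s}` times harmonic ones. -/
theorem IsHomogeneous.mem_harmonicSpan (hn : 1 ≤ n) {d : ℕ} :
    ∀ {P : MvPolynomial (Fin n) ℝ}, P.IsHomogeneous d → P ∈ harmonicSpan n d := by
  have hbase : ∀ {d : ℕ} {P : MvPolynomial (Fin n) ℝ}, P.IsHomogeneous d →
      MvPolynomial.laplacian n P = 0 → P ∈ harmonicSpan n d := fun {d P} hP h0 =>
    Submodule.subset_span ⟨0, d, P, by simp, hP, h0, by simp⟩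
  induction d using Nat.strong_induction_on with
  | _ d ih =>
    intro P hP
    by_cases hd : d < 2
    · refine hbase hP ?_
      rw [laplacian_apply]
      refine Finset.sum_eq_zero fun i _ => ?_
      have h1 : (pderiv i P).IsHomogeneous (d - 1) := hP.pderiv
      rw [show d - 1 = 0 by omega] at h1
      exact h1.pderiv_eq_zero i
    · obtain ⟨e, rfl⟩ : ∃ e, d = e + 2 := ⟨d - 2, by omega⟩
      obtain ⟨V, hV, hVP⟩ := exists_laplacian_eq_of_mem_harmonicSpan hn
        (ih e (by omega) (P := MvPolynomial.laplacian n P) hP.laplacian)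
      have h2 : P - V ∈ harmonicSpan n (e + 2) :=
        hbase (hP.sub (isHomogeneous_of_mem_harmonicSpan hV)) (by rw [map_sub, hVP, sub_self])
      simpa using Submodule.add_mem _ h2 hV

/-- Evaluation of a polynomial as a function on Euclidean space. -/
def evalFun (P : MvPolynomial (Fin n) ℝ) (x : E n) : ℝ := eval (fun i => x i) P

theorem hasFDerivAt_evalFun (P : MvPolynomial (Fin n) ℝ) (x : E n) :
    HasFDerivAt (evalFun P)
      (∑ i, evalFun (pderiv i P) x • (EuclideanSpace.proj i : E n →L[ℝ] ℝ)) x := by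
  induction P using MvPolynomial.induction_on with
  | C a =>
    have h : evalFun (n := n) (C a) = fun _ => a := by ext; simp [evalFun]
    rw [h]
    refine (hasFDerivAt_const a x).congr_fderiv ?_
    simp [evalFun]
  | add p q hp hq =>
    have h : evalFun (p + q) = evalFun p + evalFun q := by ext; simp [evalFun]
    rw [h]
    refine (hp.add hq).congr_fderiv ?_
    simp [evalFun, add_smul, Finset.sum_add_distrib]
  | mul_X p i hp =>
    have h : evalFun (p * X i) = fun y => evalFun p y * (EuclideanSpace.proj i : E n →L[ℝ] ℝ) y := by
      ext; simp [evalFun]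
    rw [h]
    refine (hp.mul (EuclideanSpace.proj i : E n →L[ℝ] ℝ).hasFDerivAt).congr_fderiv ?_
    have h2 : ∀ j, evalFun (pderiv j (p * X i)) x =
        (if j = i then evalFun p x else 0) + x i * evalFun (pderiv j p) x := by
      intro j
      by_cases hji : j = i
      · subst hji; simp [evalFun, Derivation.leibniz]
      · simp [evalFun, Derivation.leibniz, pderiv_X, hji]
    simp only [h2, add_smul, Finset.sum_add_distrib, Finset.smul_sum, mul_smul, ite_smul, zero_smul,
      Finset.sum_ite_eq', Finset.mem_univ, if_true]
    simp

theorem fderiv_evalFun_single (P : MvPolynomial (Fin n) ℝ) (x : E n) (i : Fin n) :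
    fderiv ℝ (evalFun P) x (EuclideanSpace.single i 1) = evalFun (pderiv i P) x := by
  rw [(hasFDerivAt_evalFun P x).fderiv]
  simp

theorem contDiff_evalFun (P : MvPolynomial (Fin n) ℝ) : ContDiff ℝ (⊤ : ℕ∞) (evalFun P) := by
  induction P using MvPolynomial.induction_on with
  | C a =>
    have h : evalFun (n := n) (C a) = fun _ => a := by ext; simp [evalFun]
    rw [h]
    exact contDiff_const
  | add p q hp hq =>
    have h : evalFun (p + q) = evalFun p + evalFun q := by ext; simp [evalFun]
    rw [h]
    exact hp.add hq
  | mul_X p i hp =>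
    have h : evalFun (p * X i) = fun y => evalFun p y * (EuclideanSpace.proj i : E n →L[ℝ] ℝ) y := by
      ext; simp [evalFun]
    rw [h]
    exact hp.mul (EuclideanSpace.proj i : E n →L[ℝ] ℝ).contDiff

theorem lap_evalFun (P : MvPolynomial (Fin n) ℝ) (x : E n) :
    lap n (evalFun P) x = evalFun (laplacian n P) x := by
  simp only [lap, fderiv_evalFun_single, laplacian_apply]
  simp [evalFun, map_sum]

theorem IsHomogeneous.evalFun_smul {P : MvPolynomial (Fin n) ℝ} {m : ℕ} (hP : P.IsHomogeneous m)
    (c : ℝ) (x : E n) : evalFun P (c • x) = c ^ m * evalFun P x := by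
  simp only [evalFun, eval_eq', Finset.mul_sum]
  refine Finset.sum_congr rfl fun d hd => ?_
  have h1 : ∑ i, d i = m := by
    have := hP (mem_support_iff.mp hd)
    rw [Finsupp.weight_apply, Finsupp.sum_fintype _ _ (by simp)] at this
    simpa using this
  simp only [PiLp.smul_apply, smul_eq_mul, mul_pow, Finset.prod_mul_distrib,
    Finset.prod_pow_eq_pow_sum, h1]
  ring

theorem IsHomogeneous.isHHP {P : MvPolynomial (Fin n) ℝ} {m : ℕ} (hP : P.IsHomogeneous m)
    (hharm : MvPolynomial.laplacian n P = 0) : IsHHP n m (evalFun P) :=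
  ⟨⟨P, fun _ => rfl⟩, hP.evalFun_smul, fun x => by rw [lap_evalFun, hharm]; simp [evalFun]⟩

end MvPolynomial

theorem IsHHP.exists_isHomogeneous {n m : ℕ} {p : E n → ℝ} (hp : IsHHP n m p) :
    ∃ P : MvPolynomial (Fin n) ℝ, P.IsHomogeneous m ∧ p = MvPolynomial.evalFun P := by
  obtain ⟨⟨P, hP⟩, hom, -⟩ := hp
  refine ⟨MvPolynomial.homogeneousComponent m P,
    MvPolynomial.homogeneousComponent_isHomogeneous m P, funext fun x => ?_⟩
  set a : ℕ → ℝ := fun k => MvPolynomial.evalFun (MvPolynomial.homogeneousComponent k P) x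
  set N := max (P.totalDegree + 1) (m + 1)
  have hcomp : ∀ c : ℝ, p (c • x) = ∑ k ∈ Finset.range N, c ^ k * a k := by
    intro c
    have h1 : ∑ k ∈ Finset.range N, MvPolynomial.homogeneousComponent k P = P := by
      conv_rhs => rw [← MvPolynomial.sum_homogeneousComponent P]
      symm
      refine Finset.sum_subset (Finset.range_mono (le_max_left _ _)) fun k _ hk => ?_
      refine MvPolynomial.homogeneousComponent_eq_zero _ _ ?_
      simp at hk; omega
    rw [hP]
    conv_lhs => rw [← h1, map_sum]
    refine Finset.sum_congr rfl fun k _ => ?_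
    exact (MvPolynomial.homogeneousComponent_isHomogeneous k P).evalFun_smul c x
  have hpoly : ∑ k ∈ Finset.range N, Polynomial.monomial k (a k) = Polynomial.monomial m (p x) := by
    refine Polynomial.funext fun c => ?_
    have := hcomp c
    rw [hom] at this
    simp only [Polynomial.eval_finsetSum, Polynomial.eval_monomial]
    rw [mul_comm, this]
    exact Finset.sum_congr rfl fun k _ => mul_comm _ _
  have := congrArg (fun q => Polynomial.coeff q m) hpoly
  simp only [Polynomial.finsetSum_coeff, Polynomial.coeff_monomial] at this
  rw [Finset.sum_ite_eq' ] at this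
  have hm : m ∈ Finset.range N := Finset.mem_range.mpr (lt_of_lt_of_le (Nat.lt_succ_self m)
    (le_max_right _ _))
  simp [hm] at this
  exact this.symm

open MvPolynomial in
/-- The function `|x|^s (log |x|)^i P(x)`. -/
def radialTerm {n : ℕ} (s : ℝ) (i : ℕ) (P : MvPolynomial (Fin n) ℝ) (x : E n) : ℝ :=
  ‖x‖ ^ s * Real.log ‖x‖ ^ i * evalFun P x

/-- Functions `|x|^{σ-d} (log |x|)^i P(x)` with `P` homogeneous of degree `d ≤ k`, `k - d` even,
where the triple `(σ, i, k)` is admissible. -/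
def termSet (n : ℕ) (Adm : ℝ → ℕ → ℕ → Prop) : Set (E n → ℝ) :=
  {f | ∃ (σ : ℝ) (i k d t : ℕ) (P : MvPolynomial (Fin n) ℝ), Adm σ i k ∧ P.IsHomogeneous d ∧
    k = d + 2 * t ∧ f = radialTerm (σ - d) i P}

/-- Families of triples (homogeneity, power of the logarithm, degree bound) which are stable under
the operations needed to multiply and differentiate the corresponding functions. -/
structure IsExponentFamily (Adm : ℝ → ℕ → ℕ → Prop) : Prop where
  neg : ∀ {σ i k}, Adm σ i k → σ < 0
  add : ∀ {σ i k σ' i' k'}, Adm σ i k → Adm σ' i' k' → Adm (σ + σ') (i + i') (k + k')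
  succ : ∀ {σ i k}, Adm σ i k → Adm (σ - 1) i (k + 1)
  pred_log : ∀ {σ i k}, Adm σ (i + 1) k → Adm (σ - 1) i (k + 1)

theorem norm_rpow_mul_of_neg {n : ℕ} {s t : ℝ} (hs : s < 0) (ht : t < 0) (x : E n) :
    ‖x‖ ^ s * ‖x‖ ^ t = ‖x‖ ^ (s + t) := by
  rcases eq_or_ne x 0 with rfl | hx
  · rw [norm_zero, Real.zero_rpow hs.ne, Real.zero_rpow (add_neg hs ht).ne, zero_mul]
  · rw [Real.rpow_add (norm_pos_iff.mpr hx)]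

theorem evalFun_normSq {n : ℕ} (x : E n) :
    MvPolynomial.evalFun (MvPolynomial.normSq n) x = ‖x‖ ^ 2 := by
  simp [MvPolynomial.evalFun, MvPolynomial.normSq, EuclideanSpace.norm_sq_eq]

theorem radialTerm_normSq_pow_mul {n : ℕ} {s : ℝ} {r i : ℕ} (hs : s + 2 * r < 0)
    (H : MvPolynomial (Fin n) ℝ) :
    radialTerm s i (MvPolynomial.normSq n ^ r * H) = radialTerm (s + 2 * r) i H := by
  funext x
  have h1 : MvPolynomial.evalFun (MvPolynomial.normSq n ^ r * H) x =
      (‖x‖ ^ 2) ^ r * MvPolynomial.evalFun H x := by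
    rw [← evalFun_normSq]; simp [MvPolynomial.evalFun]
  have hr : (0 : ℝ) ≤ r := Nat.cast_nonneg r
  have h2 : ‖x‖ ^ s * (‖x‖ ^ 2) ^ r = ‖x‖ ^ (s + 2 * r) := by
    rcases eq_or_ne x 0 with rfl | hx
    · rw [norm_zero, Real.zero_rpow (by linarith), Real.zero_rpow hs.ne, zero_mul]
    · rw [Real.rpow_add (norm_pos_iff.mpr hx), ← pow_mul, ← Real.rpow_natCast]
      push_cast; rfl
  simp only [radialTerm, h1, ← h2]
  ring

/-- If `A` contains the terms with harmonic polynomial part, its span contains all terms. -/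
theorem termSet_subset_span {n : ℕ} (hn : 1 ≤ n) {Adm : ℝ → ℕ → ℕ → Prop}
    (hAdm : IsExponentFamily Adm) {A : Set (E n → ℝ)}
    (hA : ∀ {σ i k m t} {H : MvPolynomial (Fin n) ℝ}, Adm σ i k → H.IsHomogeneous m →
      MvPolynomial.laplacian n H = 0 → k = m + 2 * t → radialTerm (σ - m) i H ∈ A) :
    termSet n Adm ⊆ Submodule.span ℝ A := by
  rintro _ ⟨σ, i, k, d, t, P, hadm, hP, hk, rfl⟩
  have hP' := hP.mem_harmonicSpan hn
  clear hP
  induction hP' using Submodule.span_induction with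
  | mem W h =>
    obtain ⟨s, m, H, hd, hH, hharm, rfl⟩ := h
    have h1 : σ - d + 2 * s = σ - m := by rw [← hd]; push_cast; ring
    have hm : (0 : ℝ) ≤ m := Nat.cast_nonneg m
    rw [radialTerm_normSq_pow_mul (by rw [h1]; linarith [hAdm.neg hadm]), h1]
    exact Submodule.subset_span (hA (t := s + t) hadm hH hharm (by omega))
  | zero =>
    have : radialTerm (σ - d) i (0 : MvPolynomial (Fin n) ℝ) = 0 := by
      ext; simp [radialTerm, MvPolynomial.evalFun]
    rw [this]; exact Submodule.zero_mem _
  | add a b _ _ ha hb =>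
    have : radialTerm (σ - d) i (a + b) = radialTerm (σ - d) i a + radialTerm (σ - d) i b := by
      ext; simp [radialTerm, MvPolynomial.evalFun, mul_add]
    rw [this]; exact Submodule.add_mem _ ha hb
  | smul c a _ ha =>
    have : radialTerm (σ - d) i (c • a) = c • radialTerm (σ - d) i a := by
      ext; simp [radialTerm, MvPolynomial.evalFun]; ring
    rw [this]; exact Submodule.smul_mem _ _ ha

section Terms

variable {n : ℕ} {Adm : ℝ → ℕ → ℕ → Prop}

theorem span_termSet_mul_le (hAdm : IsExponentFamily Adm) :
    Submodule.span ℝ (termSet n Adm) * Submodule.span ℝ (termSet n Adm) ≤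
      Submodule.span ℝ (termSet n Adm) := by
  rw [Submodule.span_mul_span]
  refine Submodule.span_mono ?_
  rintro _ ⟨_, ⟨σ, i, k, d, t, P, hadm, hP, hk, rfl⟩, _, ⟨σ', i', k', d', t', P', hadm', hP', hk', rfl⟩,
    rfl⟩
  refine ⟨σ + σ', i + i', k + k', d + d', t + t', P * P', hAdm.add hadm hadm', hP.mul hP',
    by omega, funext fun x => ?_⟩
  have hd : (0 : ℝ) ≤ d := Nat.cast_nonneg d
  have hd' : (0 : ℝ) ≤ d' := Nat.cast_nonneg d'
  have h1 : σ + σ' - ((d + d' : ℕ) : ℝ) = (σ - d) + (σ' - d') := by push_cast; ring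
  simp only [radialTerm, Pi.mul_apply, h1]
  rw [← norm_rpow_mul_of_neg (by linarith [hAdm.neg hadm]) (by linarith [hAdm.neg hadm'])]
  simp only [MvPolynomial.evalFun, map_mul]
  ring

theorem contDiffOn_radialTerm {R : ℝ} (hR : 1 ≤ R) (s : ℝ) (i : ℕ) (P : MvPolynomial (Fin n) ℝ) :
    ContDiffOn ℝ (⊤ : ℕ∞) (radialTerm s i P) (Sset n R) := by
  have h0 : ∀ x ∈ Sset n R, ‖x‖ ≠ 0 := fun x hx => by
    linarith [norm_pos_of_mem_Sset hR hx]
  have hnorm : ContDiffOn ℝ (⊤ : ℕ∞) (fun x : E n => ‖x‖) (Sset n R) := fun x hx =>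
    (contDiffAt_norm ℝ (norm_ne_zero_iff.mp (h0 x hx))).contDiffWithinAt
  have h1 := hnorm.rpow_const_of_ne (p := s) h0
  exact (h1.mul ((hnorm.log h0).pow i)).mul (MvPolynomial.contDiff_evalFun P).contDiffOn

theorem hasFDerivAt_norm_euclidean {x : E n} (hx : x ≠ 0) :
    HasFDerivAt (fun y : E n => ‖y‖) (‖x‖⁻¹ • innerSL ℝ x) x := by
  have h1 : HasFDerivAt (fun y : E n => ‖y‖ ^ 2) (2 • innerSL ℝ x) x :=
    (hasStrictFDerivAt_norm_sq x).hasFDerivAt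
  have h2 := h1.sqrt (by simpa using hx)
  simp only [Real.sqrt_sq (norm_nonneg _)] at h2
  refine h2.congr_fderiv ?_
  ext v
  simp
  field_simp

theorem pd_radialTerm {R : ℝ} (hR : 1 ≤ R) (s : ℝ) (i : ℕ) (P : MvPolynomial (Fin n) ℝ)
    (a : Fin n) {x : E n} (hx : x ∈ Sset n R) :
    pd n R (radialTerm s i P) a x =
      s * radialTerm (s - 2) i (MvPolynomial.X a * P) x +
      i * radialTerm (s - 2) (i - 1) (MvPolynomial.X a * P) x +
      radialTerm s i (MvPolynomial.pderiv a P) x := by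
  have hpos : 0 < ‖x‖ := by linarith [norm_pos_of_mem_Sset hR hx]
  have hx0 : x ≠ 0 := norm_pos_iff.mp hpos
  have hnorm := hasFDerivAt_norm_euclidean hx0
  have h1 := hnorm.rpow_const (p := s) (Or.inl hpos.ne')
  have h2 := (hnorm.log hpos.ne').pow i
  have h3 := (h1.mul h2).mul (MvPolynomial.hasFDerivAt_evalFun P x)
  have h4 : fderivWithin ℝ (radialTerm s i P) (Sset n R) x = _ :=
    h3.hasFDerivWithinAt.fderivWithin (uniqueDiffOn_Sset n hR x hx)
  have h5 := MvPolynomial.fderiv_evalFun_single P x a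
  rw [(MvPolynomial.hasFDerivAt_evalFun P x).fderiv] at h5
  rw [pd, h4]
  simp only [add_apply, smul_apply, smul_eq_mul, h5]
  have h6 : MvPolynomial.evalFun (MvPolynomial.X a * P) x = x a * MvPolynomial.evalFun P x := by
    simp [MvPolynomial.evalFun]
  have h7 : ‖x‖ ^ (s - 1) = ‖x‖ ^ (s - 2) * ‖x‖ := by
    rw [← Real.rpow_add_one hpos.ne']; congr 1; ring
  have h8 : ‖x‖ ^ s = ‖x‖ ^ (s - 2) * ‖x‖ ^ 2 := by
    rw [← Real.rpow_natCast, ← Real.rpow_add hpos]; congr 1; push_cast; ring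
  simp [radialTerm, h6, h7, h8, EuclideanSpace.inner_single_right]
  field_simp
  ring

theorem radialTerm_pderiv_mem (hAdm : IsExponentFamily Adm) {σ : ℝ} {i k d t : ℕ}
    {P : MvPolynomial (Fin n) ℝ} (hadm : Adm σ i k) (hP : P.IsHomogeneous d) (hk : k = d + 2 * t)
    (a : Fin n) :
    radialTerm (σ - d) i (MvPolynomial.pderiv a P) ∈ Submodule.span ℝ (termSet n Adm) := by
  rcases Nat.eq_zero_or_pos d with rfl | hd
  · have : radialTerm (σ - (0 : ℕ)) i (MvPolynomial.pderiv a P) = 0 := by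
      ext; simp [radialTerm, MvPolynomial.evalFun, hP.pderiv_eq_zero]
    rw [this]; exact Submodule.zero_mem _
  · obtain ⟨e, rfl⟩ : ∃ e, d = e + 1 := ⟨d - 1, by omega⟩
    refine Submodule.subset_span ⟨σ - 1, i, k + 1, e, t + 1,
      MvPolynomial.pderiv a P, hAdm.succ hadm, hP.pderiv, by omega, ?_⟩
    congr 1
    push_cast; ring

theorem span_termSet_regular {R : ℝ} (hR : 1 ≤ R) (hAdm : IsExponentFamily Adm) {v : E n → ℝ}
    (hv : v ∈ Submodule.span ℝ (termSet n Adm)) :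
    ContDiffOn ℝ (⊤ : ℕ∞) v (Sset n R) ∧ ∀ a : Fin n,
      ∃ w ∈ Submodule.span ℝ (termSet n Adm), Set.EqOn (pd n R v a) w (Sset n R) := by
  have hS := uniqueDiffOn_Sset n hR
  induction hv using Submodule.span_induction with
  | mem f hf =>
    obtain ⟨σ, i, k, d, t, P, hadm, hP, hk, rfl⟩ := hf
    refine ⟨contDiffOn_radialTerm hR _ _ _, fun a => ⟨_, ?_, fun x hx => pd_radialTerm hR _ _ _ a hx⟩⟩
    have hXP : (MvPolynomial.X a * P).IsHomogeneous (1 + d) :=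
      (MvPolynomial.isHomogeneous_X ℝ a).mul hP
    have hexp : σ - d - 2 = (σ - 1) - ((1 + d : ℕ) : ℝ) := by push_cast; ring
    refine Submodule.add_mem _ (Submodule.add_mem _ ?_ ?_)
      (radialTerm_pderiv_mem hAdm hadm hP hk a)
    · refine Submodule.smul_mem _ (σ - d) (Submodule.subset_span
        ⟨σ - 1, i, k + 1, 1 + d, t, _, hAdm.succ hadm, hXP, by omega, by rw [hexp]⟩)
    · cases i with
      | zero =>
        convert Submodule.zero_mem _ using 1
        ext; simp
      | succ i =>
        refine Submodule.smul_mem _ ((i + 1 : ℕ) : ℝ) (Submodule.subset_span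
          ⟨σ - 1, i, k + 1, 1 + d, t, _, hAdm.pred_log hadm, hXP, by omega, by rw [hexp]; rfl⟩)
  | zero =>
    refine ⟨contDiffOn_const, fun a => ⟨0, Submodule.zero_mem _, fun x _ => ?_⟩⟩
    have : (0 : E n → ℝ) = fun _ => (0 : ℝ) := rfl
    simp [pd, this]
  | add u v _ _ hu hv =>
    refine ⟨hu.1.add hv.1, fun a => ?_⟩
    obtain ⟨u', hu', hue⟩ := hu.2 a
    obtain ⟨v', hv', hve⟩ := hv.2 a
    refine ⟨u' + v', Submodule.add_mem _ hu' hv', fun x hx => ?_⟩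
    rw [Pi.add_apply, ← hue hx, ← hve hx]
    simp only [pd]
    rw [fderivWithin_add (hS x hx) (hu.1.differentiableOn (by simp) x hx)
      (hv.1.differentiableOn (by simp) x hx)]
    rfl
  | smul c u _ hu =>
    refine ⟨contDiffOn_const.smul hu.1, fun a => ?_⟩
    obtain ⟨u', hu', hue⟩ := hu.2 a
    refine ⟨c • u', Submodule.smul_mem _ _ hu', fun x hx => ?_⟩
    rw [Pi.smul_apply, ← hue hx]
    simp only [pd]
    rw [fderivWithin_const_smul (hS x hx) (hu.1.differentiableOn (by simp) x hx)]
    rfl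

end Terms

theorem exists_exponentFamily {n : ℕ} (hn : 4 ≤ n) {A : Set (E n → ℝ)}
    (hA : A = if n = 4 then TtildeG n else Tset n) :
    ∃ Adm, IsExponentFamily Adm ∧ Submodule.span ℝ A = Submodule.span ℝ (termSet n Adm) := by
  have hn' : (4 : ℝ) ≤ n := by exact_mod_cast hn
  by_cases h4 : n = 4
  · rw [if_pos h4] at hA
    subst hA
    have hAdm : IsExponentFamily fun σ i k => ∃ l : ℕ, 1 ≤ l ∧ l + i ≤ k ∧
        σ = ((2 : ℝ) - n) * l - k := by
      constructor
      · rintro σ i k ⟨l, hl, hik, rfl⟩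
        have h1 : (1 : ℝ) ≤ l := by exact_mod_cast hl
        have h2 : (0 : ℝ) ≤ k := Nat.cast_nonneg k
        nlinarith
      · rintro σ i k σ' i' k' ⟨l, hl, hik, rfl⟩ ⟨l', hl', hik', rfl⟩
        exact ⟨l + l', by omega, by omega, by push_cast; ring⟩
      · rintro σ i k ⟨l, hl, hik, rfl⟩
        exact ⟨l, by omega, by omega, by push_cast; ring⟩
      · rintro σ i k ⟨l, hl, hik, rfl⟩
        exact ⟨l, by omega, by omega, by push_cast; ring⟩
    refine ⟨_, hAdm, le_antisymm (Submodule.span_mono ?_)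
      (Submodule.span_le.mpr (termSet_subset_span (by omega) hAdm ?_))⟩
    · rintro _ ⟨l, k, i, m, p, hp, hl, hik, hmk, ⟨t, ht⟩, rfl⟩
      obtain ⟨P, hP, rfl⟩ := hp.exists_isHomogeneous
      exact ⟨_, i, k, m, t, P, ⟨l, hl, hik, rfl⟩, hP, by omega, rfl⟩
    · rintro σ i k m t H ⟨l, hl, hik, rfl⟩ hH hharm hk
      exact ⟨l, k, i, m, _, hH.isHHP hharm, hl, hik, by omega, ⟨t, by omega⟩, rfl⟩
  · rw [if_neg h4] at hA
    subst hA
    have hAdm : IsExponentFamily fun σ i k => i = 0 ∧ ∃ j l : ℕ, j + 1 ≤ l ∧ l ≤ k ∧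
        σ = 2 * (j : ℝ) - ((n : ℝ) - 2) * l - k := by
      constructor
      · rintro σ i k ⟨-, j, l, hj, hl, rfl⟩
        have h1 : (j : ℝ) + 1 ≤ l := by exact_mod_cast hj
        have h2 : (0 : ℝ) ≤ k := Nat.cast_nonneg k
        have h3 : (0 : ℝ) ≤ l := Nat.cast_nonneg l
        nlinarith
      · rintro σ i k σ' i' k' ⟨rfl, j, l, hj, hl, rfl⟩ ⟨rfl, j', l', hj', hl', rfl⟩
        exact ⟨rfl, j + j', l + l', by omega, by omega, by push_cast; ring⟩
      · rintro σ i k ⟨rfl, j, l, hj, hl, rfl⟩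
        exact ⟨rfl, j, l, by omega, by omega, by push_cast; ring⟩
      · rintro σ i k ⟨h, -⟩
        omega
    refine ⟨_, hAdm, le_antisymm (Submodule.span_mono ?_)
      (Submodule.span_le.mpr (termSet_subset_span (by omega) hAdm ?_))⟩
    · rintro _ ⟨j, l, k, m, p, hp, hj, hl, hmk, ⟨t, ht⟩, rfl⟩
      obtain ⟨P, hP, rfl⟩ := hp.exists_isHomogeneous
      exact ⟨_, 0, k, m, t, P, ⟨rfl, j, l, hj, hl, rfl⟩, hP, by omega,
        by funext x; simp [radialTerm]⟩
    · rintro σ i k m t H ⟨rfl, j, l, hj, hl, rfl⟩ hH hharm hk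
      exact ⟨j, l, k, m, _, hH.isHHP hharm, hj, hl, by omega, ⟨t, by omega⟩,
        by funext x; simp [radialTerm]⟩

/-- Smooth functions on `{|x| ≥ R}` which are `O(-a)` and agree with an element of `B` up to
`O(-b)`. -/
structure ExpandsIn (n : ℕ) (R : ℝ) (B : Submodule ℝ (E n → ℝ)) (a b : ℝ) (u : E n → ℝ) :
    Prop where
  bigOh : SmoothBigOh n R a u
  exists_sub : ∃ v ∈ B, SmoothBigOh n R b (fun x => u x - v x)

namespace ExpandsIn

variable {n : ℕ} {R : ℝ} {B B₁ B₂ : Submodule ℝ (E n → ℝ)} {a b a₁ b₁ a₂ b₂ : ℝ} {u v : E n → ℝ}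

theorem congr (hu : ExpandsIn n R B a b u) (huv : Set.EqOn v u (Sset n R)) :
    ExpandsIn n R B a b v := by
  obtain ⟨w, hw, h⟩ := hu.exists_sub
  exact ⟨hu.bigOh.congr huv, w, hw, h.congr fun x hx => by simp only [huv hx]⟩

theorem mono (hR : 1 ≤ R) (hu : ExpandsIn n R B₁ a₁ b₁ u) (hB : B₁ ≤ B) (ha : a ≤ a₁)
    (hb : b ≤ b₁) : ExpandsIn n R B a b u := by
  obtain ⟨w, hw, h⟩ := hu.exists_sub
  exact ⟨hu.bigOh.mono hR ha, w, hB hw, h.mono hR hb⟩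

theorem add (hR : 1 ≤ R) (hu : ExpandsIn n R B a b u) (hv : ExpandsIn n R B a b v) :
    ExpandsIn n R B a b (fun x => u x + v x) := by
  obtain ⟨w, hw, h⟩ := hu.exists_sub
  obtain ⟨w', hw', h'⟩ := hv.exists_sub
  refine ⟨hu.bigOh.add hR hv.bigOh, w + w', B.add_mem hw hw', (h.add hR h').congr fun x _ => ?_⟩
  simp only [Pi.add_apply]
  ring

theorem neg (hR : 1 ≤ R) (hu : ExpandsIn n R B a b u) : ExpandsIn n R B a b (fun x => -u x) := by
  obtain ⟨w, hw, h⟩ := hu.exists_sub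
  refine ⟨hu.bigOh.neg hR, -w, B.neg_mem hw, (h.neg hR).congr fun x _ => ?_⟩
  simp only [Pi.neg_apply]
  ring

theorem sub (hR : 1 ≤ R) (hu : ExpandsIn n R B a b u) (hv : ExpandsIn n R B a b v) :
    ExpandsIn n R B a b (fun x => u x - v x) :=
  (hu.add hR (hv.neg hR)).congr fun _ _ => sub_eq_add_neg _ _

theorem const_mul (hR : 1 ≤ R) (c : ℝ) (hu : ExpandsIn n R B a b u) :
    ExpandsIn n R B a b (fun x => c * u x) := by
  obtain ⟨w, hw, h⟩ := hu.exists_sub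
  have h1 := (SmoothBigOh.const (n := n) (R := R) c).mul hR hu.bigOh
  have h2 := (SmoothBigOh.const (n := n) (R := R) c).mul hR h
  rw [zero_add] at h1 h2
  refine ⟨h1, c • w, B.smul_mem c hw, h2.congr fun x _ => ?_⟩
  simp only [Pi.smul_apply, smul_eq_mul]
  ring

theorem sum (hR : 1 ≤ R) {ι : Type*} [Fintype ι] [Nonempty ι] {u : ι → E n → ℝ}
    (hu : ∀ i, ExpandsIn n R B a b (u i)) : ExpandsIn n R B a b (fun x => ∑ i, u i x) := by
  classical
  have h : ∀ s : Finset ι, ExpandsIn n R B a b (fun x => ∑ i ∈ s, u i x) := by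
    intro s
    induction s using Finset.induction_on with
    | empty =>
      obtain ⟨i⟩ := ‹Nonempty ι›
      exact ((hu i).const_mul hR 0).congr fun _ _ => by simp
    | insert i s hi ih =>
      exact ((hu i).add hR ih).congr fun _ _ => by simp [Finset.sum_insert hi]
  exact h Finset.univ

theorem mul (hR : 1 ≤ R) (hu : ExpandsIn n R B₁ a₁ b₁ u) (hv : ExpandsIn n R B₂ a₂ b₂ v)
    (hB : B₁ * B₂ ≤ B) (hab : a₁ ≤ b₁) (ha : a ≤ a₁ + a₂) (hb : b ≤ b₁ + a₂) (hb' : b ≤ a₁ + b₂) :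
    ExpandsIn n R B a b (fun x => u x * v x) := by
  obtain ⟨w, hw, h⟩ := hu.exists_sub
  obtain ⟨w', hw', h'⟩ := hv.exists_sub
  have hw1 : SmoothBigOh n R a₁ w :=
    (hu.bigOh.sub hR (h.mono hR hab)).congr fun x _ => by simp only; ring
  refine ⟨(hu.bigOh.mul hR hv.bigOh).mono hR ha, w * w', hB (Submodule.mul_mem_mul hw hw'),
    (((h.mul hR hv.bigOh).mono hR hb).add hR ((hw1.mul hR h').mono hR hb')).congr fun x _ => ?_⟩
  simp only [Pi.mul_apply]
  ring

theorem pd (hR : 1 ≤ R) (hu : ExpandsIn n R B a b u)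
    (hB : ∀ v ∈ B, ContDiffOn ℝ (⊤ : ℕ∞) v (Sset n R) ∧ ∀ i : Fin n,
      ∃ w ∈ B, Set.EqOn (pd n R v i) w (Sset n R)) (i : Fin n) :
    ExpandsIn n R B (a + 1) (b + 1) (pd n R u i) := by
  obtain ⟨w, hw, h⟩ := hu.exists_sub
  obtain ⟨hws, hwd⟩ := hB w hw
  obtain ⟨w', hw', hwe⟩ := hwd i
  refine ⟨hu.bigOh.pd hR i, w', hw', (h.pd hR i).congr fun x hx => ?_⟩
  simp only [← hwe hx, _root_.pd]
  rw [fderivWithin_fun_sub (uniqueDiffOn_Sset n hR x hx)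
    (hu.bigOh.smooth.differentiableOn (by simp) x hx) (hws.differentiableOn (by simp) x hx)]
  rfl

end ExpandsIn

/-- The deviation of the inverse matrix from the identity decays at the same rate. -/
theorem smoothBigOh_inv_sub_one {n : ℕ} {R q : ℝ} (hR : 1 ≤ R) (hq : 0 < q)
    {g : E n → Matrix (Fin n) (Fin n) ℝ} (hginv : ∀ x ∈ Sset n R, IsUnit (g x))
    (hg : ∀ i j, SmoothBigOh n R q (fun x => g x i j - if i = j then 1 else 0)) (i j : Fin n) :
    SmoothBigOh n R q (fun x => (g x)⁻¹ i j - if i = j then 1 else 0) := by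
  have hg0 : ∀ i j, SmoothBigOh n R 0 (fun x => g x i j) := fun i j =>
    (((hg i j).mono hR hq.le).add hR (SmoothBigOh.const (if i = j then 1 else 0))).congr
      fun _ _ => by ring
  have hdet : SmoothBigOh n R 0 (fun x => (g x).det) := SmoothBigOh.det hR hg0
  have hdet0 : ∀ x ∈ Sset n R, (g x).det ≠ 0 := fun x hx =>
    ((Matrix.isUnit_iff_isUnit_det _).mp (hginv x hx)).ne_zero
  obtain ⟨c, hc, hcdet⟩ : ∃ c : ℝ, 0 < c ∧ ∀ x ∈ Sset n R, c ≤ |(g x).det| := by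
    set L : Filter (E n) := Filter.comap norm Filter.atTop ⊓ Filter.principal (Sset n R)
    have hent : ∀ i j, Filter.Tendsto (fun x => g x i j - if i = j then 1 else 0) L (nhds 0) := by
      intro i j
      obtain ⟨C, hC⟩ := (hg i j).bigOh 0
      have h1 : Filter.Tendsto (fun x : E n => C * ‖x‖ ^ (-q)) L (nhds 0) := by
        rw [← mul_zero C]
        exact (((tendsto_rpow_neg_atTop hq).comp Filter.tendsto_comap).mono_left
          inf_le_left).const_mul C
      refine squeeze_zero_norm' ?_ h1
      have : ∀ᶠ x in L, x ∈ Sset n R := Filter.mem_inf_of_right (Filter.mem_principal_self _)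
      filter_upwards [this] with x hx
      simpa using hC x hx
    have hmat : Filter.Tendsto g L (nhds 1) := by
      refine tendsto_pi_nhds.mpr fun i => tendsto_pi_nhds.mpr fun j => ?_
      have := (hent i j).add_const ((1 : Matrix (Fin n) (Fin n) ℝ) i j)
      simpa [Matrix.one_apply] using this
    have hdetlim : Filter.Tendsto (fun x => |(g x).det|) L (nhds 1) := by
      have h1 : Continuous fun M : Matrix (Fin n) (Fin n) ℝ => |M.det| :=
        (continuous_id.matrix_det).abs
      have := (h1.tendsto 1).comp hmat
      simpa [Function.comp_def] using this
    have hev : ∀ᶠ x in L, (1 / 2 : ℝ) < |(g x).det| := hdetlim.eventually_const_lt (by norm_num)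
    rw [Filter.eventually_inf_principal, Filter.eventually_comap, Filter.eventually_atTop] at hev
    obtain ⟨ρ, hρ⟩ := hev
    have hclosed : IsClosed (Sset n R) := isClosed_le continuous_const continuous_norm
    have hcomp : IsCompact (Sset n R ∩ Metric.closedBall 0 ρ) :=
      (isCompact_closedBall (0 : E n) ρ).inter_left hclosed
    have hcont : ContinuousOn (fun x => |(g x).det|) (Sset n R ∩ Metric.closedBall 0 ρ) :=
      hdet.smooth.continuousOn.abs.mono Set.inter_subset_left
    obtain ⟨c, hc, hcx⟩ : ∃ c : ℝ, 0 < c ∧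
        ∀ x ∈ Sset n R ∩ Metric.closedBall 0 ρ, c ≤ |(g x).det| := by
      rcases (Sset n R ∩ Metric.closedBall 0 ρ).eq_empty_or_nonempty with he | hne
      · exact ⟨1, one_pos, fun x hx => by rw [he] at hx; exact hx.elim⟩
      · obtain ⟨y, hy, hmin⟩ := hcomp.exists_isMinOn hne hcont
        exact ⟨_, abs_pos.mpr (hdet0 y hy.1), fun x hx => hmin hx⟩
    refine ⟨min c (1 / 2), lt_min hc (by norm_num), fun x hx => ?_⟩
    by_cases hxρ : ‖x‖ ≤ ρ
    · exact (min_le_left _ _).trans (hcx x ⟨hx, by simpa using hxρ⟩)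
    · exact (min_le_right _ _).trans (hρ ‖x‖ (not_le.mp hxρ).le x rfl hx).le
  have hdetinv := hdet.inv hR hc hcdet
  have hinv0 : ∀ i j, SmoothBigOh n R 0 (fun x => (g x)⁻¹ i j) := by
    intro i j
    have hadj : SmoothBigOh n R 0 (fun x => (g x).adjugate i j) := by
      simp only [Matrix.adjugate_apply]
      refine SmoothBigOh.det hR fun k l => ?_
      by_cases hk : k = j
      · subst hk
        simpa using SmoothBigOh.const (n := n) (R := R) ((Pi.single i (1 : ℝ) : Fin n → ℝ) l)
      · simpa [Matrix.updateRow_apply, hk] using hg0 k l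
    have := hdetinv.mul hR hadj
    rw [zero_add] at this
    refine this.congr fun x _ => ?_
    simp [Matrix.inv_def]
  have hsum : SmoothBigOh n R q (fun x => ∑ k, (g x i k - if i = k then 1 else 0) * (g x)⁻¹ k j) := by
    have : ∀ s : Finset (Fin n), SmoothBigOh n R q
        (fun x => ∑ k ∈ s, (g x i k - if i = k then 1 else 0) * (g x)⁻¹ k j) := by
      intro s
      induction s using Finset.induction_on with
      | empty =>
        have h0 := (hg i i).mul hR (SmoothBigOh.const (n := n) (R := R) 0)
        rw [add_zero] at h0
        exact h0.congr fun _ _ => by simp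
      | insert k s hk ih =>
        have h0 := (hg i k).mul hR (hinv0 k j)
        rw [add_zero] at h0
        exact (h0.add hR ih).congr fun _ _ => by simp [Finset.sum_insert hk]
    exact this Finset.univ
  refine (hsum.neg hR).congr fun x hx => ?_
  have h1 : g x * (g x)⁻¹ = 1 := Matrix.mul_nonsing_inv _
    ((Matrix.isUnit_iff_isUnit_det _).mp (hginv x hx))
  have h2 := congrFun (congrFun h1 i) j
  rw [Matrix.mul_apply, Matrix.one_apply] at h2
  simp only [sub_mul, Finset.sum_sub_distrib, h2, ite_mul, one_mul, zero_mul, Finset.sum_ite_eq,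
    Finset.mem_univ, if_true]
  ring

/-- The deviation of the inverse matrix from the identity has an expansion to the same order. -/
theorem expandsIn_inv_sub_one {n : ℕ} {R q b : ℝ} (hn : 1 ≤ n) (hR : 1 ≤ R) (hq : 0 < q)
    (hqb : q ≤ b) {B : Submodule ℝ (E n → ℝ)} (hB : B * B ≤ B)
    {g : E n → Matrix (Fin n) (Fin n) ℝ} (hginv : ∀ x ∈ Sset n R, IsUnit (g x))
    (hg : ∀ i j, ExpandsIn n R B q b (fun x => g x i j - if i = j then 1 else 0)) (i j : Fin n) :
    ExpandsIn n R B q b (fun x => (g x)⁻¹ i j - if i = j then 1 else 0) := by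
  have : Nonempty (Fin n) := ⟨⟨0, hn⟩⟩
  have hO := smoothBigOh_inv_sub_one hR hq hginv fun i j => (hg i j).bigOh
  have key : ∀ (k : ℕ) (i j : Fin n), ExpandsIn n R B q (min b ((k + 1) * q))
      (fun x => (g x)⁻¹ i j - if i = j then 1 else 0) := by
    intro k
    induction k with
    | zero =>
      intro i j
      refine ⟨hO i j, 0, B.zero_mem, ((hO i j).mono hR ?_).congr fun x _ => by simp⟩
      simp
    | succ k ih =>
      intro i j
      have hk : (0 : ℝ) ≤ k := Nat.cast_nonneg k
      have hprod : ExpandsIn n R B q (min b ((k + 1 + 1) * q)) (fun x => ∑ l,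
          (g x i l - if i = l then 1 else 0) * ((g x)⁻¹ l j - if l = j then 1 else 0)) := by
        refine ExpandsIn.sum hR fun l => (hg i l).mul hR (ih l j) hB hqb (by linarith)
          ((min_le_left _ _).trans (by linarith)) ?_
        rw [← min_add_add_left]
        exact min_le_min (by linarith) (by linarith)
      push_cast
      refine (((hg i j).mono hR le_rfl le_rfl (min_le_left _ _)).add hR hprod |>.neg hR).congr
        fun x hx => ?_
      have h1 : g x * (g x)⁻¹ = 1 := Matrix.mul_nonsing_inv _
        ((Matrix.isUnit_iff_isUnit_det _).mp (hginv x hx))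
      have h2 := congrFun (congrFun h1 i) j
      rw [Matrix.mul_apply, Matrix.one_apply] at h2
      simp only [sub_mul, mul_sub, Finset.sum_sub_distrib, h2, ite_mul, mul_ite, one_mul, zero_mul,
        mul_one, mul_zero, Finset.sum_ite_eq, Finset.sum_ite_eq', Finset.mem_univ, if_true]
      ring
  obtain ⟨k, hk⟩ := exists_nat_ge (b / q)
  rw [div_le_iff₀ hq] at hk
  exact (key k i j).mono hR le_rfl le_rfl (le_min le_rfl (by linarith))

/-- A constant plus a function with a decaying expansion. -/
theorem ExpandsIn.of_sub_const {n : ℕ} {R a b : ℝ} (hR : 1 ≤ R) {B : Submodule ℝ (E n → ℝ)}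
    {u : E n → ℝ} {c : ℝ} (ha : 0 ≤ a) (hu : ExpandsIn n R B a b (fun x => u x - c)) :
    ExpandsIn n R (1 ⊔ B) 0 b u := by
  obtain ⟨w, hw, h⟩ := hu.exists_sub
  refine ⟨((hu.bigOh.mono hR ha).add hR (SmoothBigOh.const c)).congr fun _ _ => by simp,
    algebraMap ℝ (E n → ℝ) c + w, Submodule.add_mem_sup (Submodule.algebraMap_mem c) hw,
    h.congr fun x _ => ?_⟩
  simp only [Pi.add_apply, Pi.algebraMap_apply, Algebra.algebraMap_self, RingHom.id_apply]
  ring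

theorem pd_sub_const {n : ℕ} {R : ℝ} (u : E n → ℝ) (c : ℝ) (i : Fin n) :
    pd n R (fun x => u x - c) i = pd n R u i := by
  funext x
  rw [pd, fderivWithin_sub_const, pd]

/-- structure of the right-hand side `RHS_{ij}` of the Ricci flat
equation in harmonic coordinates: if every `g_{ij} - δ_{ij}` has an expansion with
terms in `A` (`A = 𝒯` for `n ≥ 5`, `A = 𝒯̃` for `n = 4`) up to order `-q_N`,
`q_N = N(n-1)`, then each `RHS_{ij}` has an expansion with terms in
`𝓛_{A×A} = SPAN({u·v : u, v ∈ A})` up to order `-(q_N + n + 1)`. -/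
theorem RHS_structure (n : ℕ) (hn : 4 ≤ n) (R : ℝ) (hR : 1 ≤ R) (N : ℕ) (hN : 1 ≤ N)
    (A : Set (E n → ℝ)) (hA : A = if n = 4 then TtildeG n else Tset n)
    (g : E n → Matrix (Fin n) (Fin n) ℝ)
    (hginv : ∀ x ∈ Sset n R, IsUnit (g x))
    (hgsmooth : ∀ i j : Fin n, ContDiffOn ℝ (⊤ : ℕ∞) (fun x => g x i j) (Sset n R))
    (hgO : ∀ i j : Fin n,
      BigOh n R ((n:ℝ) - 1) (fun x => g x i j - if i = j then 1 else 0))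
    (hgexp : ∀ i j : Fin n,
      HasExpansion n R A ((N:ℝ) * ((n:ℝ) - 1))
        (fun x => g x i j - if i = j then 1 else 0)) :
    ∀ i j : Fin n,
      HasExpansion n R {w : E n → ℝ | ∃ u ∈ A, ∃ v ∈ A, w = u * v}
        ((N:ℝ) * ((n:ℝ) - 1) + n + 1)
        (fun x =>
          -(∑ k : Fin n, ∑ l : Fin n,
              ((g x)⁻¹ k l - if k = l then 1 else 0) *
                pd n R (fun y => pd n R (fun z => g z i j) l y) k x)
          + (-(∑ k : Fin n, ∑ l : Fin n, ∑ p' : Fin n, ∑ q' : Fin n,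
                (g x)⁻¹ p' q' * g x l j *
                  pd n R (fun z => g z i k) p' x *
                  pd n R (fun z => (g z)⁻¹ k l) q' x)
             - 2 * ∑ k : Fin n, ∑ l : Fin n, ∑ p' : Fin n, ∑ q' : Fin n,
                 ∑ r : Fin n, ∑ s : Fin n,
                 g x i k * g x l j * (g x)⁻¹ p' q' * (g x)⁻¹ r s *
                   ((1/2) * ∑ mm : Fin n, (g x)⁻¹ k mm *
                     (pd n R (fun z => g z p' mm) r x
                       + pd n R (fun z => g z mm r) p' x
                       - pd n R (fun z => g z p' r) mm x)) *
                   ((1/2) * ∑ mm : Fin n, (g x)⁻¹ l mm *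
                     (pd n R (fun z => g z q' mm) s x
                       + pd n R (fun z => g z mm s) q' x
                       - pd n R (fun z => g z q' s) mm x)))) := by
  obtain ⟨Adm, hAdm, hspan⟩ := exists_exponentFamily hn hA
  have : Nonempty (Fin n) := ⟨⟨0, by omega⟩⟩
  set B := Submodule.span ℝ A with hBdef
  have hBmul : B * B ≤ B := hspan ▸ span_termSet_mul_le hAdm
  have hBreg : ∀ v ∈ B, ContDiffOn ℝ (⊤ : ℕ∞) v (Sset n R) ∧ ∀ i : Fin n,
      ∃ w ∈ B, Set.EqOn (pd n R v i) w (Sset n R) := by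
    intro v hv
    rw [hspan] at hv ⊢
    exact span_termSet_regular hR hAdm hv
  have hBB : Submodule.span ℝ {w : E n → ℝ | ∃ u ∈ A, ∃ v ∈ A, w = u * v} = B * B := by
    rw [hBdef, Submodule.span_mul_span]
    congr 1
    ext w
    simp only [Set.mem_mul, Set.mem_ofPred_eq, eq_comm]
  have hn' : (4 : ℝ) ≤ n := by exact_mod_cast hn
  have hN' : (1 : ℝ) ≤ N := by exact_mod_cast hN
  obtain ⟨ε, ⟨hε0, hε1⟩, hε⟩ : ∃ ε ∈ Set.Ioo (0 : ℝ) 1, ∀ i j, ∃ v ∈ B,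
      BigOh n R (N * ((n : ℝ) - 1) + ε) (fun x => g x i j - (if i = j then 1 else 0) - v x) := by
    choose e he v hv hO using hgexp
    obtain ⟨p₀, hp₀⟩ := Finite.exists_min fun p : Fin n × Fin n => e p.1 p.2
    refine ⟨e p₀.1 p₀.2, he _ _, fun i j => ⟨v i j, hv i j, ?_⟩⟩
    have hsm : ContDiffOn ℝ (⊤ : ℕ∞) (fun x => g x i j - (if i = j then 1 else 0) - v i j x)
        (Sset n R) := ((hgsmooth i j).sub contDiffOn_const).sub (hBreg _ (hv i j)).1
    exact (SmoothBigOh.mono hR ⟨hsm, hO i j⟩ (by linarith [hp₀ (i, j)])).bigOh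
  set Q : ℝ := N * ((n : ℝ) - 1) + ε with hQ
  have hnQ : (n : ℝ) - 1 ≤ Q := by nlinarith
  have hg : ∀ i j, ExpandsIn n R B (n - 1) Q (fun x => g x i j - if i = j then 1 else 0) := by
    intro i j
    have hsm := (hgsmooth i j).sub (contDiffOn_const (c := if i = j then (1 : ℝ) else 0))
    obtain ⟨v, hv, hO⟩ := hε i j
    exact ⟨⟨hsm, hgO i j⟩, v, hv, hsm.sub (hBreg v hv).1, hO⟩
  have hinv := expandsIn_inv_sub_one (by omega) hR (by linarith) hnQ hBmul hginv hg
  have hg0 : ∀ i j, ExpandsIn n R (1 ⊔ B) 0 Q (fun x => g x i j) := fun i j =>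
    (hg i j).of_sub_const hR (by linarith)
  have hinv0 : ∀ i j, ExpandsIn n R (1 ⊔ B) 0 Q (fun x => (g x)⁻¹ i j) := fun i j =>
    (hinv i j).of_sub_const hR (by linarith)
  have hdg : ∀ i j k, ExpandsIn n R B n (Q + 1) (pd n R (fun z => g z i j) k) := by
    intro i j k
    have := (hg i j).pd hR hBreg k
    rwa [pd_sub_const, sub_add_cancel] at this
  have hdinv : ∀ i j k, ExpandsIn n R B n (Q + 1) (pd n R (fun z => (g z)⁻¹ i j) k) := by
    intro i j k
    have := (hinv i j).pd hR hBreg k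
    rwa [pd_sub_const, sub_add_cancel] at this
  have hddg : ∀ i j k l, ExpandsIn n R B (n + 1) (Q + 1 + 1)
      (pd n R (fun y => pd n R (fun z => g z i j) l y) k) := fun i j k l =>
    (hdg i j l).pd hR hBreg k
  have hone : ∀ {M : Submodule ℝ (E n → ℝ)}, B * M ≤ M → (1 ⊔ B) * M ≤ M := fun {M} hM => by
    rw [Submodule.sup_mul, Submodule.one_mul]
    exact sup_le le_rfl hM
  have h00 : (1 ⊔ B) * (1 ⊔ B) ≤ 1 ⊔ B := by
    rw [Submodule.sup_mul, Submodule.one_mul, Submodule.mul_sup, Submodule.mul_one]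
    exact sup_le le_rfl (sup_le le_sup_right (hBmul.trans le_sup_right))
  have hmul0 : ∀ {u v : E n → ℝ}, ExpandsIn n R (1 ⊔ B) 0 Q u → ExpandsIn n R (1 ⊔ B) 0 Q v →
      ExpandsIn n R (1 ⊔ B) 0 Q (fun x => u x * v x) := fun hu hv =>
    hu.mul hR hv h00 (by linarith) (by linarith) (by linarith) (by linarith)
  have hmul1 : ∀ {u v : E n → ℝ}, ExpandsIn n R (1 ⊔ B) 0 Q u → ExpandsIn n R B n (Q + 1) v →
      ExpandsIn n R B n (Q + 1) (fun x => u x * v x) := fun hu hv =>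
    hu.mul hR hv (hone hBmul) (by linarith) (by linarith) (by linarith) (by linarith)
  have hmul11 : ∀ {u v : E n → ℝ}, ExpandsIn n R B n (Q + 1) u → ExpandsIn n R B n (Q + 1) v →
      ExpandsIn n R (B * B) (2 * n) (Q + n + 1) (fun x => u x * v x) := fun hu hv =>
    hu.mul hR hv le_rfl (by linarith) (by linarith) (by linarith) (by linarith)
  have hΓ : ∀ k p r, ExpandsIn n R B n (Q + 1) (fun x => (1 / 2) * ∑ mm : Fin n, (g x)⁻¹ k mm *
      (pd n R (fun z => g z p mm) r x + pd n R (fun z => g z mm r) p x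
        - pd n R (fun z => g z p r) mm x)) := fun k p r =>
    (ExpandsIn.sum hR fun mm => hmul1 (hinv0 k mm)
      (((hdg p mm r).add hR (hdg mm r p)).sub hR (hdg p r mm))).const_mul hR _
  intro i j
  have hterm1 : ExpandsIn n R (B * B) (2 * n) (Q + n + 1) (fun x => ∑ k : Fin n, ∑ l : Fin n,
      ((g x)⁻¹ k l - if k = l then 1 else 0) *
        pd n R (fun y => pd n R (fun z => g z i j) l y) k x) :=
    ExpandsIn.sum hR fun k => ExpandsIn.sum hR fun l =>
      (hinv k l).mul hR (hddg i j k l) le_rfl hnQ (by linarith) (by linarith) (by linarith)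
  have hterm2 : ExpandsIn n R (B * B) (2 * n) (Q + n + 1) (fun x => ∑ k : Fin n, ∑ l : Fin n,
      ∑ p' : Fin n, ∑ q' : Fin n, (g x)⁻¹ p' q' * g x l j * pd n R (fun z => g z i k) p' x *
        pd n R (fun z => (g z)⁻¹ k l) q' x) :=
    ExpandsIn.sum hR fun k => ExpandsIn.sum hR fun l => ExpandsIn.sum hR fun p' =>
      ExpandsIn.sum hR fun q' => hmul11 (hmul1 (hmul0 (hinv0 p' q') (hg0 l j)) (hdg i k p'))
        (hdinv k l q')
  have hterm3 := ExpandsIn.sum hR fun k => ExpandsIn.sum hR fun l => ExpandsIn.sum hR fun p' =>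
    ExpandsIn.sum hR fun q' => ExpandsIn.sum hR fun r => ExpandsIn.sum hR fun s =>
      hmul11 (hmul1 (hmul0 (hmul0 (hmul0 (hg0 i k) (hg0 l j)) (hinv0 p' q')) (hinv0 r s))
        (hΓ k p' r)) (hΓ l q' s)
  obtain ⟨v, hv, hO⟩ := ((hterm1.neg hR).add hR
    ((hterm2.neg hR).sub hR (hterm3.const_mul hR 2))).exists_sub
  refine ⟨ε, ⟨hε0, hε1⟩, v, hBB ▸ hv, ?_⟩
  have hexp : N * ((n : ℝ) - 1) + n + 1 + ε = Q + n + 1 := by rw [hQ]; ring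
  rw [hexp]
  exact hO.bigOh
end
end

section
/- Let n ≥ 5 and let T₁, T₂ ∈ 𝒯. Then there exists V ∈ SPAN(𝒯) such that ΔV(x) = T₁(x)·T₂(x) for all x ∈ ℝⁿ with x ≠ 0. -/
open Real
open scoped BigOperators

noncomputable section

open MvPolynomial

namespace HarmonicExpansion

lemma weight_one_eq_degree {ι : Type*} (a : ι →₀ ℕ) : Finsupp.weight (1 : ι → ℕ) a = a.degree := by
  rw [Finsupp.degree_eq_weight_one]
  rfl

section Polynomial

variable {ι : Type*} [Fintype ι]

/-- The Laplacian of a polynomial. -/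
def polyLap : MvPolynomial ι ℝ →ₗ[ℝ] MvPolynomial ι ℝ :=
  ∑ i, (pderiv i).toLinearMap ∘ₗ (pderiv i).toLinearMap

lemma polyLap_apply (P : MvPolynomial ι ℝ) : polyLap P = ∑ i, pderiv i (pderiv i P) := by
  simp [polyLap]

/-- The polynomial `∑ i, X i ^ 2`. -/
def radSq : MvPolynomial ι ℝ := ∑ i, X i ^ 2

lemma isHomogeneous_radSq : (radSq : MvPolynomial ι ℝ).IsHomogeneous 2 :=
  IsHomogeneous.sum _ _ _ fun i _ => isHomogeneous_X_pow i 2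

lemma pderiv_radSq (i : ι) : pderiv i (radSq : MvPolynomial ι ℝ) = 2 * X i := by
  classical
  simp only [radSq, map_sum, pderiv_pow, pderiv_X]
  rw [Finset.sum_eq_single i]
  · simp
  · intro j _ hj
    simp [hj.symm]
  · simp

lemma IsHomogeneous.polyLap {P : MvPolynomial ι ℝ} {d : ℕ} (h : P.IsHomogeneous d) :
    (polyLap P).IsHomogeneous (d - 2) := by
  rw [polyLap_apply]
  exact IsHomogeneous.sum _ _ _ fun i _ => h.pderiv.pderiv

lemma polyLap_eq_zero_of_degree_le_one {P : MvPolynomial ι ℝ} {d : ℕ} (h : P.IsHomogeneous d)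
    (hd : d ≤ 1) : polyLap P = 0 := by
  rw [polyLap_apply]
  refine Finset.sum_eq_zero fun i _ => ?_
  have h0 : (pderiv i P).IsHomogeneous 0 := by
    simpa [Nat.sub_eq_zero_of_le hd] using h.pderiv (i := i)
  rw [← totalDegree_zero_iff_isHomogeneous, totalDegree_eq_zero_iff_eq_C] at h0
  rw [h0, pderiv_C]

lemma polyLap_radSq_mul {P : MvPolynomial ι ℝ} {d : ℕ} (h : P.IsHomogeneous d) :
    polyLap (radSq * P) = (2 * Fintype.card ι + 4 * d : ℝ) • P + radSq * polyLap P := by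
  have key (i : ι) : pderiv i (pderiv i (radSq * P)) =
      2 * P + 4 * (X i * pderiv i P) + radSq * pderiv i (pderiv i P) := by
    have h2 : pderiv i (2 : MvPolynomial ι ℝ) = 0 := pderiv_C (a := (2 : ℝ))
    simp only [pderiv_mul, map_add, pderiv_radSq, pderiv_X_self, h2]
    ring
  rw [polyLap_apply, polyLap_apply, Finset.sum_congr rfl fun i _ => key i,
    Finset.sum_add_distrib, Finset.sum_add_distrib, ← Finset.mul_sum, ← Finset.mul_sum,
    ← Finset.mul_sum, h.sum_X_mul_pderiv]
  simp only [Finset.sum_const, Finset.card_univ, nsmul_eq_mul, smul_eq_C_mul, map_add, map_mul,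
    map_natCast, map_ofNat]
  ring

lemma exists_polyLap_radSq_pow_mul [Nonempty ι] {H : MvPolynomial ι ℝ} {d : ℕ}
    (h : H.IsHomogeneous d) (hH : polyLap H = 0) (i : ℕ) :
    ∃ c : ℝ, 0 < c ∧ polyLap (radSq ^ (i + 1) * H) = c • (radSq ^ i * H) := by
  have hcard : (0 : ℝ) < Fintype.card ι := by exact_mod_cast Fintype.card_pos
  induction i with
  | zero =>
    refine ⟨2 * Fintype.card ι + 4 * d, by positivity, ?_⟩
    simp [polyLap_radSq_mul h, hH]
  | succ i ih =>
    obtain ⟨c, hc, hcH⟩ := ih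
    refine ⟨2 * Fintype.card ι + 4 * (2 * (i + 1) + d : ℕ) + c, by positivity, ?_⟩
    rw [pow_succ', mul_assoc, polyLap_radSq_mul ((isHomogeneous_radSq.pow (i + 1)).mul h), hcH,
      add_smul _ c, mul_smul_comm, ← mul_assoc, ← pow_succ']

/-- Products of a power of `radSq` with a harmonic homogeneous polynomial, of total degree `d`. -/
def radialHarmonics (ι : Type*) [Fintype ι] (d : ℕ) : Set (MvPolynomial ι ℝ) :=
  {F | ∃ (i m : ℕ) (H : MvPolynomial ι ℝ), 2 * i + m = d ∧ H.IsHomogeneous m ∧ polyLap H = 0 ∧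
    F = radSq ^ i * H}

lemma isHomogeneous_of_mem_span_radialHarmonics {F : MvPolynomial ι ℝ} {d : ℕ}
    (hF : F ∈ Submodule.span ℝ (radialHarmonics ι d)) : F.IsHomogeneous d := by
  have hle : Submodule.span ℝ (radialHarmonics ι d) ≤ homogeneousSubmodule ι ℝ d := by
    rw [Submodule.span_le]
    rintro _ ⟨i, m, H, rfl, hH, -, rfl⟩
    exact (isHomogeneous_radSq.pow i).mul hH
  exact hle hF

lemma exists_polyLap_eq_of_mem_span [Nonempty ι] {F : MvPolynomial ι ℝ} {d : ℕ}
    (hF : F ∈ Submodule.span ℝ (radialHarmonics ι d)) :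
    ∃ Q ∈ Submodule.span ℝ (radialHarmonics ι (d + 2)), polyLap Q = F := by
  have hle : Submodule.span ℝ (radialHarmonics ι d) ≤
      (Submodule.span ℝ (radialHarmonics ι (d + 2))).map polyLap := by
    rw [Submodule.span_le]
    rintro _ ⟨i, m, H, rfl, hm, hH, rfl⟩
    obtain ⟨c, hc, hcH⟩ := exists_polyLap_radSq_pow_mul hm hH i
    refine ⟨c⁻¹ • (radSq ^ (i + 1) * H), Submodule.smul_mem _ _ (Submodule.subset_span
      ⟨i + 1, m, H, by ring, hm, hH, rfl⟩), ?_⟩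
    rw [map_smul, hcH, inv_smul_smul₀ hc.ne']
  exact hle hF

/-- Every homogeneous polynomial is a sum of products of powers of `radSq` with harmonic
homogeneous polynomials. -/
lemma mem_span_radialHarmonics [Nonempty ι] {P : MvPolynomial ι ℝ} {d : ℕ}
    (h : P.IsHomogeneous d) : P ∈ Submodule.span ℝ (radialHarmonics ι d) := by
  induction d using Nat.strong_induction_on generalizing P with
  | _ d ih =>
    rcases Nat.lt_or_ge d 2 with hd | hd
    · exact Submodule.subset_span ⟨0, d, P, by simp, h,
        polyLap_eq_zero_of_degree_le_one h (by omega), by simp⟩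
    · obtain ⟨e, rfl⟩ := Nat.exists_eq_add_of_le' hd
      obtain ⟨Q, hQ, hQP⟩ := exists_polyLap_eq_of_mem_span (ih e (by omega) (P := polyLap P)
        (by simpa using IsHomogeneous.polyLap h))
      rw [← sub_add_cancel P Q]
      refine Submodule.add_mem _ (Submodule.subset_span ⟨0, e + 2, P - Q, by simp,
        h.sub (isHomogeneous_of_mem_span_radialHarmonics hQ), ?_, by simp⟩) hQ
      rw [map_sub, hQP, sub_self]

/-- A polynomial that scales like a homogeneous one is homogeneous. -/
lemma isHomogeneous_of_eval_smul {P : MvPolynomial ι ℝ} {d : ℕ}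
    (h : ∀ (c : ℝ) (x : ι → ℝ), eval (c • x) P = c ^ d * eval x P) : P.IsHomogeneous d := by
  classical
  have hP : (∑ a ∈ P.support, monomial a (2 ^ a.degree * coeff a P)) = C (2 ^ d) * P := by
    refine MvPolynomial.funext fun x => ?_
    rw [map_mul, eval_C, ← h 2 x, map_sum, eval_eq]
    refine Finset.sum_congr rfl fun a _ => ?_
    simp only [eval_monomial, Pi.smul_apply, smul_eq_mul, mul_pow, Finset.prod_mul_distrib,
      Finset.prod_pow_eq_pow_sum, Finsupp.prod_fintype, pow_zero, implies_true,
      Finsupp.degree_eq_sum]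
    have : ∏ i ∈ a.support, x i ^ a i = ∏ i, x i ^ a i :=
      Finset.prod_subset (Finset.subset_univ _) (by simp +contextual)
    have : ∑ i ∈ a.support, a i = ∑ i, a i :=
      Finset.sum_subset (Finset.subset_univ _) (by simp +contextual)
    simp_all
    ring
  intro a ha
  have hc := congrArg (coeff a) hP
  simp only [coeff_sum, coeff_monomial, coeff_C_mul, Finset.sum_ite_eq', mem_support_iff, ne_eq,
    ha, not_false_eq_true, if_true] at hc
  have := mul_right_cancel₀ ha hc
  rw [weight_one_eq_degree]
  exact Nat.pow_right_injective le_rfl (by exact_mod_cast this)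

end Polynomial

section Function

variable {n : ℕ}

/-- The function on Euclidean space defined by a polynomial. -/
def polyFun (P : MvPolynomial (Fin n) ℝ) (x : E n) : ℝ := eval (fun i => x i) P

lemma hasFDerivAt_coord (i : Fin n) (x : E n) :
    HasFDerivAt (fun y : E n => y i) (EuclideanSpace.proj i : E n →L[ℝ] ℝ) x :=
  (EuclideanSpace.proj i : E n →L[ℝ] ℝ).hasFDerivAt

lemma contDiff_polyFun (P : MvPolynomial (Fin n) ℝ) {k : WithTop ℕ∞} :
    ContDiff ℝ k (polyFun P) := by
  induction P using MvPolynomial.induction_on with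
  | C a =>
    have : polyFun (C a : MvPolynomial (Fin n) ℝ) = fun _ => a := by ext; simp [polyFun]
    exact this ▸ contDiff_const
  | add P Q hP hQ =>
    have : polyFun (P + Q) = fun x => polyFun P x + polyFun Q x := by ext; simp [polyFun]
    exact this ▸ hP.add hQ
  | mul_X P i hP =>
    have hX : ContDiff ℝ k fun y : E n => y i := (EuclideanSpace.proj i : E n →L[ℝ] ℝ).contDiff
    have : polyFun (P * X i) = fun x => polyFun P x * x i := by ext; simp [polyFun]
    exact this ▸ hP.mul hX

lemma differentiableAt_polyFun (P : MvPolynomial (Fin n) ℝ) (x : E n) :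
    DifferentiableAt ℝ (polyFun P) x :=
  (contDiff_polyFun P (k := 1)).differentiable one_ne_zero x

lemma fderiv_polyFun (P : MvPolynomial (Fin n) ℝ) (x : E n) (i : Fin n) :
    fderiv ℝ (polyFun P) x (EuclideanSpace.single i 1) = polyFun (pderiv i P) x := by
  classical
  induction P using MvPolynomial.induction_on with
  | C a =>
    have : polyFun (C a : MvPolynomial (Fin n) ℝ) = fun _ => a := by ext; simp [polyFun]
    simp [this, polyFun]
  | add P Q hP hQ =>
    have : polyFun (P + Q) = polyFun P + polyFun Q := by ext; simp [polyFun]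
    rw [this, fderiv_add (differentiableAt_polyFun P x) (differentiableAt_polyFun Q x)]
    simp [hP, hQ, polyFun]
  | mul_X P j hP =>
    have : polyFun (P * X j) = polyFun P * fun y => y j := by ext; simp [polyFun]
    rw [this, ((differentiableAt_polyFun P x).hasFDerivAt.mul (hasFDerivAt_coord j x)).fderiv]
    simp only [add_apply, smul_apply, hP]
    rcases eq_or_ne j i with rfl | hij
    · simp [polyFun]
    · simp [polyFun, pderiv_X_of_ne hij, hij]

lemma lap_polyFun (P : MvPolynomial (Fin n) ℝ) (x : E n) :
    lap n (polyFun P) x = polyFun (polyLap P) x := by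
  simp only [lap, fderiv_polyFun, polyLap_apply]
  simp only [polyFun, map_sum]

lemma polyFun_radSq (x : E n) : polyFun radSq x = ‖x‖ ^ 2 := by
  simp [polyFun, radSq, EuclideanSpace.norm_sq_eq]

lemma isHHP_polyFun {P : MvPolynomial (Fin n) ℝ} {m : ℕ} (h : P.IsHomogeneous m)
    (hP : polyLap P = 0) : IsHHP n m (polyFun P) := by
  refine ⟨⟨P, fun _ => rfl⟩, fun c x => ?_, fun x => ?_⟩
  · simp only [polyFun, eval_eq, Finset.mul_sum]
    refine Finset.sum_congr rfl fun a ha => ?_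
    have hdeg : ∑ i ∈ a.support, a i = m := by
      rw [← h (mem_support_iff.1 ha), weight_one_eq_degree]
      rfl
    simp only [PiLp.smul_apply, smul_eq_mul, mul_pow, Finset.prod_mul_distrib,
      Finset.prod_pow_eq_pow_sum, hdeg]
    ring
  · rw [lap_polyFun, hP]
    simp [polyFun]

lemma IsHHP.exists_polyFun {p : E n → ℝ} {m : ℕ} (h : IsHHP n m p) :
    ∃ P : MvPolynomial (Fin n) ℝ, P.IsHomogeneous m ∧ p = polyFun P := by
  obtain ⟨⟨P, hP⟩, hs, -⟩ := h
  refine ⟨P, isHomogeneous_of_eval_smul fun c x => ?_, _root_.funext hP⟩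
  have := hs c (WithLp.toLp 2 x)
  rw [hP, hP] at this
  exact this

lemma contDiffAt_norm_rpow {x : E n} (hx : x ≠ 0) (s : ℝ) {k : WithTop ℕ∞} :
    ContDiffAt ℝ k (fun y : E n => ‖y‖ ^ s) x :=
  (contDiffAt_norm ℝ hx).rpow_const_of_ne (norm_ne_zero_iff.2 hx)

lemma hasFDerivAt_norm_rpow_of_ne {x : E n} (hx : x ≠ 0) (s : ℝ) :
    HasFDerivAt (fun y : E n => ‖y‖ ^ s) ((s * ‖x‖ ^ (s - 2)) • innerSL ℝ x) x := by
  have hpos : 0 < ‖x‖ := norm_pos_iff.2 hx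
  have h := (hasStrictFDerivAt_norm_sq x).hasFDerivAt.rpow_const (p := s / 2)
    (Or.inl (pow_ne_zero 2 hpos.ne'))
  have he (y : E n) : (‖y‖ ^ 2) ^ (s / 2) = ‖y‖ ^ s := by
    rw [← Real.rpow_natCast_mul (norm_nonneg y)]
    congr 1
    push_cast
    ring
  simp only [he] at h
  convert! h using 1
  rw [← Real.rpow_natCast_mul hpos.le, show ((2 : ℕ) : ℝ) * (s / 2 - 1) = s - 2 by push_cast; ring]
  ext y
  simp
  ring

lemma fderiv_norm_rpow_mul_polyFun {x : E n} (hx : x ≠ 0) (s : ℝ) (P : MvPolynomial (Fin n) ℝ)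
    (i : Fin n) :
    fderiv ℝ (fun y : E n => ‖y‖ ^ s * polyFun P y) x (EuclideanSpace.single i 1) =
      s * (‖x‖ ^ (s - 2) * polyFun (X i * P) x) + ‖x‖ ^ s * polyFun (pderiv i P) x := by
  rw [((hasFDerivAt_norm_rpow_of_ne hx s).fun_mul
    (differentiableAt_polyFun P x).hasFDerivAt).fderiv]
  simp [fderiv_polyFun, polyFun, EuclideanSpace.inner_single_right]
  ring

lemma contDiffAt_norm_rpow_mul_polyFun {x : E n} (hx : x ≠ 0) (s : ℝ)
    (P : MvPolynomial (Fin n) ℝ) {k : WithTop ℕ∞} :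
    ContDiffAt ℝ k (fun y : E n => ‖y‖ ^ s * polyFun P y) x :=
  (contDiffAt_norm_rpow hx s).mul (contDiff_polyFun P).contDiffAt

lemma lap_norm_rpow_mul_polyFun {x : E n} (hx : x ≠ 0) (s : ℝ) {P : MvPolynomial (Fin n) ℝ}
    {m : ℕ} (h : P.IsHomogeneous m) (hP : polyLap P = 0) :
    lap n (fun y : E n => ‖y‖ ^ s * polyFun P y) x =
      s * (s + 2 * m + n - 2) * (‖x‖ ^ (s - 2) * polyFun P x) := by
  have key (i : Fin n) :
      fderiv ℝ (fun y => fderiv ℝ (fun y : E n => ‖y‖ ^ s * polyFun P y) y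
        (EuclideanSpace.single i 1)) x (EuclideanSpace.single i 1) =
      s * (s - 2) * (‖x‖ ^ (s - 2 - 2) * polyFun P x) * x i ^ 2 +
        s * ‖x‖ ^ (s - 2) * polyFun P x +
        2 * s * ‖x‖ ^ (s - 2) * polyFun (X i * pderiv i P) x +
        ‖x‖ ^ s * polyFun (pderiv i (pderiv i P)) x := by
    have hev : (fun y => fderiv ℝ (fun y : E n => ‖y‖ ^ s * polyFun P y) y
        (EuclideanSpace.single i 1)) =ᶠ[nhds x] fun y =>
        s * (‖y‖ ^ (s - 2) * polyFun (X i * P) y) + ‖y‖ ^ s * polyFun (pderiv i P) y := by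
      filter_upwards [isOpen_ne.mem_nhds hx] with y hy
      exact fderiv_norm_rpow_mul_polyFun hy s P i
    have hd (t : ℝ) (Q : MvPolynomial (Fin n) ℝ) :
        DifferentiableAt ℝ (fun y : E n => ‖y‖ ^ t * polyFun Q y) x :=
      (contDiffAt_norm_rpow_mul_polyFun hx t Q (k := 1)).differentiableAt one_ne_zero
    rw [hev.fderiv_eq, fderiv_fun_add ((hd _ _).const_mul s) (hd _ _), fderiv_const_mul (hd _ _)]
    simp only [add_apply, smul_apply, smul_eq_mul,
      fderiv_norm_rpow_mul_polyFun hx]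
    simp [polyFun]
    ring
  have hEuler : ∑ i, polyFun (X i * pderiv i P) x = m * polyFun P x := by
    have := congrArg (fun Q => polyFun Q x) h.sum_X_mul_pderiv
    simpa [polyFun] using this
  have hLap : ∑ i, polyFun (pderiv i (pderiv i P)) x = 0 := by
    have := congrArg (fun Q => polyFun Q x) hP
    simpa [polyFun, polyLap_apply] using this
  have hnorm : ‖x‖ ^ (s - 2 - 2) * ‖x‖ ^ 2 = ‖x‖ ^ (s - 2) := by
    rw [← Real.rpow_add_natCast (norm_ne_zero_iff.2 hx)]
    congr 1
    push_cast
    ring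
  have hsq : ∑ i, x i ^ 2 = ‖x‖ ^ 2 := by simp [EuclideanSpace.norm_sq_eq]
  rw [lap, Finset.sum_congr rfl fun i _ => key i]
  simp only [Finset.sum_add_distrib, ← Finset.mul_sum, hEuler, hLap, hsq, Finset.sum_const,
    Finset.card_univ, Fintype.card_fin, nsmul_eq_mul]
  linear_combination s * (s - 2) * polyFun P x * hnorm

lemma differentiableAt_fderiv_apply {f : E n → ℝ} {x : E n} (hf : ContDiffAt ℝ 2 f x) (v : E n) :
    DifferentiableAt ℝ (fun y => fderiv ℝ f y v) x :=
  ((hf.fderiv_right (m := 1) (by norm_num)).differentiableAt one_ne_zero).clm_apply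
    (differentiableAt_const v)

lemma lap_add {f g : E n → ℝ} {x : E n} (hf : ContDiffAt ℝ 2 f x) (hg : ContDiffAt ℝ 2 g x) :
    lap n (f + g) x = lap n f x + lap n g x := by
  rw [lap, lap, lap, ← Finset.sum_add_distrib]
  refine Finset.sum_congr rfl fun i _ => ?_
  have hev : (fun y => fderiv ℝ (f + g) y (EuclideanSpace.single i 1)) =ᶠ[nhds x] fun y =>
      fderiv ℝ f y (EuclideanSpace.single i 1) + fderiv ℝ g y (EuclideanSpace.single i 1) := by
    filter_upwards [hf.eventually (by simp), hg.eventually (by simp)] with y hfy hgy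
    rw [fderiv_add (hfy.differentiableAt two_ne_zero) (hgy.differentiableAt two_ne_zero)]
    rfl
  rw [hev.fderiv_eq, fderiv_fun_add (differentiableAt_fderiv_apply hf _)
    (differentiableAt_fderiv_apply hg _)]
  rfl

lemma lap_const_smul (c : ℝ) (f : E n → ℝ) (x : E n) : lap n (c • f) x = c * lap n f x := by
  rw [lap, lap, Finset.mul_sum]
  refine Finset.sum_congr rfl fun i _ => ?_
  have hev : (fun y => fderiv ℝ (c • f) y (EuclideanSpace.single i 1)) =
      c • fun y => fderiv ℝ f y (EuclideanSpace.single i 1) := by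
    ext y
    simp [fderiv_const_smul_field]
  rw [hev, fderiv_const_smul_field]
  rfl

/-- The Poisson equation for a homogeneous right-hand side built on a single harmonic. -/
lemma exists_lap_eq_of_harmonic (hn : 5 ≤ n) {j l k m : ℕ} (hjl : j + 2 ≤ l) (hlk : l ≤ k)
    (hmk : m ≤ k) (hkm : Even (k - m)) {H : MvPolynomial (Fin n) ℝ} (hH : H.IsHomogeneous m)
    (hH0 : polyLap H = 0) :
    ∃ V ∈ Submodule.span ℝ (Tset n), ∀ x : E n, x ≠ 0 → ContDiffAt ℝ 2 V x ∧
      lap n V x = ‖x‖ ^ (2 * (j : ℝ) - ((n : ℝ) - 2) * l - k - m) * polyFun H x := by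
  set s : ℝ := 2 * ((j + 1 : ℕ) : ℝ) - ((n : ℝ) - 2) * l - k - m with hs
  have hT : (fun x : E n => ‖x‖ ^ s * polyFun H x) ∈ Tset n :=
    ⟨j + 1, l, k, m, polyFun H, isHHP_polyFun hH hH0, by omega, hlk, hmk, hkm, rfl⟩
  have hn' : (5 : ℝ) ≤ n := by exact_mod_cast hn
  have hjl' : (j : ℝ) + 2 ≤ l := by exact_mod_cast hjl
  have hmk' : (m : ℝ) ≤ k := by exact_mod_cast hmk
  have hj : (0 : ℝ) ≤ j := j.cast_nonneg
  have hm : (0 : ℝ) ≤ m := m.cast_nonneg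
  have hs0 : s < 0 := by
    push_cast at hs
    nlinarith
  have hs1 : s + 2 * m + n - 2 < 0 := by
    push_cast at hs
    nlinarith
  have hc : s * (s + 2 * m + n - 2) ≠ 0 := mul_ne_zero hs0.ne hs1.ne
  refine ⟨(s * (s + 2 * m + n - 2))⁻¹ • fun x => ‖x‖ ^ s * polyFun H x,
    Submodule.smul_mem _ _ (Submodule.subset_span hT), fun x hx =>
    ⟨contDiffAt_const.smul (contDiffAt_norm_rpow_mul_polyFun hx s H), ?_⟩⟩
  rw [lap_const_smul, lap_norm_rpow_mul_polyFun hx s hH hH0, inv_mul_cancel_left₀ hc,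
    show s - 2 = 2 * (j : ℝ) - ((n : ℝ) - 2) * l - k - m by rw [hs]; push_cast; ring]

/-- The Poisson equation for a homogeneous right-hand side of the form power times polynomial. -/
lemma exists_lap_eq_of_homogeneous (hn : 5 ≤ n) {j l k d : ℕ} (hjl : j + 2 ≤ l) (hlk : l ≤ k)
    (hdk : d ≤ k) (hkd : Even (k - d)) {P : MvPolynomial (Fin n) ℝ} (hP : P.IsHomogeneous d) :
    ∃ V ∈ Submodule.span ℝ (Tset n), ∀ x : E n, x ≠ 0 → ContDiffAt ℝ 2 V x ∧
      lap n V x = ‖x‖ ^ (2 * (j : ℝ) - ((n : ℝ) - 2) * l - k - d) * polyFun P x := by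
  have : Nonempty (Fin n) := ⟨⟨0, by omega⟩⟩
  have hmem := mem_span_radialHarmonics hP
  clear hP
  induction hmem using Submodule.span_induction with
  | mem F hF =>
    obtain ⟨i, m, H, rfl, hm, hH, rfl⟩ := hF
    obtain ⟨V, hV, hVx⟩ := exists_lap_eq_of_harmonic hn hjl hlk (by omega : m ≤ k)
      (by rw [Nat.even_iff] at hkd ⊢; omega) hm hH
    refine ⟨V, hV, fun x hx => ⟨(hVx x hx).1, ?_⟩⟩
    have hmul : polyFun (radSq ^ i * H) x = ‖x‖ ^ (2 * i) * polyFun H x := by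
      rw [pow_mul, ← polyFun_radSq]
      simp [polyFun]
    rw [(hVx x hx).2, hmul, ← mul_assoc, ← Real.rpow_add_natCast (norm_ne_zero_iff.2 hx)]
    congr 2
    push_cast
    ring
  | zero =>
    refine ⟨0, Submodule.zero_mem _, fun x _ => ⟨contDiffAt_const, ?_⟩⟩
    simpa [polyFun] using lap_const_smul 0 (0 : E n → ℝ) x
  | add F G _ _ hF hG =>
    obtain ⟨V, hV, hVx⟩ := hF
    obtain ⟨W, hW, hWx⟩ := hG
    refine ⟨V + W, Submodule.add_mem _ hV hW, fun x hx =>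
      ⟨(hVx x hx).1.add (hWx x hx).1, ?_⟩⟩
    rw [lap_add (hVx x hx).1 (hWx x hx).1, (hVx x hx).2, (hWx x hx).2, ← mul_add]
    simp [polyFun]
  | smul c F _ hF =>
    obtain ⟨V, hV, hVx⟩ := hF
    refine ⟨c • V, Submodule.smul_mem _ c hV, fun x hx =>
      ⟨contDiffAt_const.smul (hVx x hx).1, ?_⟩⟩
    rw [lap_const_smul, (hVx x hx).2, mul_left_comm]
    simp [polyFun]

end Function

end HarmonicExpansion

open HarmonicExpansion in
/-- for `n ≥ 5`, `ΔV = T₁·T₂` (`T₁, T₂ ∈ 𝒯`) has a solution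
`V ∈ SPAN(𝒯)` on `ℝⁿ∖{0}`. -/
theorem poisson_product_solvable (n : ℕ) (hn : 5 ≤ n) (T₁ T₂ : E n → ℝ)
    (h₁ : T₁ ∈ Tset n) (h₂ : T₂ ∈ Tset n) :
    ∃ V ∈ Submodule.span ℝ (Tset n), ∀ x : E n, x ≠ 0 →
      lap n V x = T₁ x * T₂ x := by
  obtain ⟨j₁, l₁, k₁, m₁, p₁, hp₁, hjl₁, hlk₁, hmk₁, he₁, rfl⟩ := h₁
  obtain ⟨j₂, l₂, k₂, m₂, p₂, hp₂, hjl₂, hlk₂, hmk₂, he₂, rfl⟩ := h₂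
  obtain ⟨P₁, hP₁, rfl⟩ := IsHHP.exists_polyFun hp₁
  obtain ⟨P₂, hP₂, rfl⟩ := IsHHP.exists_polyFun hp₂
  obtain ⟨V, hV, hVx⟩ := exists_lap_eq_of_homogeneous hn (j := j₁ + j₂) (l := l₁ + l₂)
    (k := k₁ + k₂) (by omega) (by omega) (by omega)
    (by rw [Nat.even_iff] at he₁ he₂ ⊢; omega) (hP₁.mul hP₂)
  refine ⟨V, hV, fun x hx => ?_⟩
  have hmul : polyFun (P₁ * P₂) x = polyFun P₁ x * polyFun P₂ x := by simp [polyFun]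
  rw [(hVx x hx).2, hmul, mul_mul_mul_comm, ← Real.rpow_add (norm_pos_iff.2 hx)]
  congr 2
  push_cast
  ring
end
end
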